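/- Let t ≥ 1 be an integer. The mean of N_t over the self-conjugate partitions of n satisfies lim_{n→∞} ( (1/sc(n)) Σ_{λ ∈ SC(n)} N_t(λ) − √(6n)/π ) = −t/2 + 3/π² + δ_t/4. -/

import Mathlib

open scoped Real Classical
open Complex Filter Asymptotics

noncomputable section

/-- The conjugate part `λ'_k`: the number of parts of `P` that are at least `k`. -/
def colLen {n : ℕ} (P : n.Partition) (k : ℕ) : ℕ :=
  Multiset.card (P.parts.filter (fun p => k ≤ p))

/-- The part `λ_j` (the `j`-th largest part, 1-indexed), recovered by conjugating twice. -/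
def rowLen {n : ℕ} (P : n.Partition) (j : ℕ) : ℕ :=
  ((Finset.Icc 1 n).filter (fun k => j ≤ colLen P k)).card

/-- The hook number `h(j,k) = (λ_j - j) + (λ'_k - k) + 1` of the cell `(j,k)` (1-indexed). -/
def hookNum {n : ℕ} (P : n.Partition) (j k : ℕ) : ℤ :=
  ((rowLen P j : ℤ) - j) + ((colLen P k : ℤ) - k) + 1

/-- `N_t(λ)`: the number of cells of the Young diagram of `λ` with hook number `t`. -/
def Nhook {n : ℕ} (t : ℕ) (P : n.Partition) : ℕ :=
  (((Finset.Icc 1 n) ×ˢ (Finset.Icc 1 n)).filter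
    (fun c => c.2 ≤ rowLen P c.1 ∧ hookNum P c.1 c.2 = (t : ℤ))).card

/-- A partition is self-conjugate if `λ_k = λ'_k` for all `k ≥ 1`. -/
def IsSelfConjugate {n : ℕ} (P : n.Partition) : Prop :=
  ∀ k, 1 ≤ k → rowLen P k = colLen P k

/-- `SC(n)`, the set of self-conjugate partitions of `n`. -/
def SC (n : ℕ) : Finset (Nat.Partition n) :=
  Finset.univ.filter (fun P => IsSelfConjugate P)

/-- `δ_t = 1` if `t` is odd, else `0`. -/
def delta (t : ℕ) : ℝ := if Odd t then 1 else 0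

/-- The region `D_θ = { r e^{iα} : r ≥ 0, |α| ≤ θ }`. -/
def Dset (θ : ℝ) : Set ℂ := {z | z = 0 ∨ |z.arg| ≤ θ}

/-- The filter of punctured neighborhoods of `0` intersected with `D_θ`. -/
def near0 (θ : ℝ) : Filter ℂ := nhdsWithin 0 (Dset θ \ {0})

/-- The dilogarithm `Li₂(X) = -∫₀¹ log(1 - Xu)/u du` (principal logarithm). -/
def Li2 (X : ℂ) : ℂ := -∫ u in (0:ℝ)..1, Complex.log (1 - X * u) / (u : ℂ)

/-- The real dilogarithm, for real arguments `x < 1`. -/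
def Li2R (x : ℝ) : ℝ := -∫ u in (0:ℝ)..1, Real.log (1 - x * u) / u

/-- The principal complex square root. -/
def csqrt (z : ℂ) : ℂ := z ^ ((1:ℂ)/2)

/-- The infinite Pochhammer symbol `(a;q)_∞ = ∏_{j ≥ 0} (1 - a q^j)`. -/
def pochInf (a q : ℂ) : ℂ := ∏' j : ℕ, (1 - a * q ^ j)

/-- The finite Pochhammer symbol `(a;q)_n = ∏_{j=0}^{n-1} (1 - a q^j)`. -/
def pochN (a q : ℂ) (n : ℕ) : ℂ := ∏ j ∈ Finset.range n, (1 - a * q ^ j)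

/-- `C_T^+ = 1 + √((1-T)/(1+T))`. -/
def Cp (T : ℝ) : ℂ := 1 + csqrt ((1 - (T:ℂ)) / (1 + (T:ℂ)))

/-- `C_T^- = 1 - √((1-T)/(1+T))`. -/
def Cm (T : ℝ) : ℂ := 1 - csqrt ((1 - (T:ℂ)) / (1 + (T:ℂ)))

/-- `H*(T;q) = (1/(2T)) [ C_T^+ (√(1-T²);-q)_∞ + C_T^- (-√(1-T²);-q)_∞ ]`. -/
def Hstar (T : ℝ) (q : ℂ) : ℂ :=
  1 / (2 * (T:ℂ)) * (Cp T * pochInf (csqrt (1 - (T:ℂ)^2)) (-q)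
    + Cm T * pochInf (-csqrt (1 - (T:ℂ)^2)) (-q))

/-- `α_T^+ = (1/(2T)) ( C_T^+ + C_T^- √((1+√(1-T²))/(1-√(1-T²))) )`. -/
def alphaP (T : ℝ) : ℂ :=
  1 / (2 * (T:ℂ)) *
    (Cp T + Cm T * csqrt ((1 + csqrt (1 - (T:ℂ)^2)) / (1 - csqrt (1 - (T:ℂ)^2))))

/-- `α_T^- = (1/(2T)) ( C_T^+ - C_T^- √((1+√(1-T²))/(1-√(1-T²))) )`. -/
def alphaM (T : ℝ) : ℂ :=
  1 / (2 * (T:ℂ)) *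
    (Cp T - Cm T * csqrt ((1 + csqrt (1 - (T:ℂ)^2)) / (1 - csqrt (1 - (T:ℂ)^2))))

/-- `b_t(T)` from Proposition: saddle-point constant. -/
def bt (t : ℕ) (T : ℝ) : ℝ :=
  if Even t then (1/2) * Real.sqrt (π^2/6 - Li2R (1 - T^2))
  else (1/2) * Real.sqrt (π^2/6 - ((t-1 : ℝ)/t) * Li2R (1 - T^2))

end

noncomputable section

/-! ### Finite sets of naturals as sets of distinct odd numbers -/

/-- The sum of the odd numbers `2a+1`, `a ∈ S`. -/
def oddWeight (S : Finset ℕ) : ℕ := ∑ a ∈ S, (2 * a + 1)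

/-- The finite sets `S` for which the odd numbers `2a+1`, `a ∈ S`, sum to `n`. -/
def oddSets (n : ℕ) : Finset (Finset ℕ) :=
  (Finset.range n).powerset.filter (fun S => oddWeight S = n)

theorem mem_oddSets {n : ℕ} {S : Finset ℕ} : S ∈ oddSets n ↔ oddWeight S = n := by
  simp only [oddSets, Finset.mem_filter, Finset.mem_powerset, and_iff_right_iff_imp]
  rintro rfl a ha
  have := Finset.single_le_sum (f := fun a : ℕ => 2 * a + 1) (fun _ _ => Nat.zero_le _) ha
  simp only [Finset.mem_range, oddWeight]
  lia

theorem subset_range_of_mem_oddSets {n : ℕ} {S : Finset ℕ} (h : S ∈ oddSets n) :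
    S ⊆ Finset.range n := by
  simp only [oddSets, Finset.mem_filter, Finset.mem_powerset] at h
  exact h.1

/-- Trading the elements of `U` for those of `V` changes the weight by a constant. -/
theorem card_filter_oddSets_exchange {m n : ℕ} {U V : Finset ℕ} (hUV : Disjoint U V)
    (h : n + oddWeight V = m + oddWeight U) :
    ((oddSets n).filter (fun S => U ⊆ S ∧ Disjoint V S)).card =
      ((oddSets m).filter (fun S => V ⊆ S ∧ Disjoint U S)).card := by
  have key : ∀ {m n : ℕ} {U V : Finset ℕ}, Disjoint U V → n + oddWeight V = m + oddWeight U →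
      ∀ S ∈ (oddSets n).filter (fun S => U ⊆ S ∧ Disjoint V S),
        (S \ U) ∪ V ∈ (oddSets m).filter (fun S => V ⊆ S ∧ Disjoint U S) := by
    intro m n U V hUV h S hS
    simp only [Finset.mem_filter, mem_oddSets] at hS ⊢
    obtain ⟨hw, hU, hV⟩ := hS
    refine ⟨?_, Finset.subset_union_right, ?_⟩
    · have h1 : oddWeight (S \ U) + oddWeight U = oddWeight S := Finset.sum_sdiff hU
      have h2 : oddWeight ((S \ U) ∪ V) = oddWeight (S \ U) + oddWeight V :=
        Finset.sum_union (hV.symm.mono_left Finset.sdiff_subset)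
      lia
    · rw [Finset.disjoint_union_right]
      exact ⟨Finset.disjoint_sdiff, hUV⟩
  have inv : ∀ {U V S : Finset ℕ}, U ⊆ S → Disjoint V S → (((S \ U) ∪ V) \ V) ∪ U = S := by
    intro U V S hU hV
    ext x
    have h1 : x ∈ U → x ∈ S := fun h => hU h
    have h2 : x ∈ V → x ∉ S := fun h => Finset.disjoint_left.1 hV h
    simp only [Finset.mem_union, Finset.mem_sdiff]
    tauto
  refine Finset.card_bij' (fun S _ => (S \ U) ∪ V) (fun S _ => (S \ V) ∪ U)
    (key hUV h) (key hUV.symm h.symm) ?_ ?_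
  · intro S hS
    simp only [Finset.mem_filter] at hS
    exact inv hS.2.1 hS.2.2
  · intro S hS
    simp only [Finset.mem_filter] at hS
    exact inv hS.2.1 hS.2.2

/-- The number of cells with hook number `t` in the self-conjugate partition with diagonal
hook numbers `2a+1`, `a ∈ S`. -/
def hookPairs (t : ℕ) (S : Finset ℕ) : ℕ :=
  2 * (S.filter (fun a => t ≤ a ∧ a - t ∉ S)).card +
    (S.filter (fun a => a < t ∧ t - 1 - a ∈ S)).card

theorem hookPairs_eq {t N : ℕ} {S : Finset ℕ} (hS : S ⊆ Finset.range N) :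
    hookPairs t S = 2 * ((Finset.range N).filter (fun b => b ∉ S ∧ b + t ∈ S)).card +
      ((Finset.range t).filter (fun a => a ∈ S ∧ t - 1 - a ∈ S)).card := by
  unfold hookPairs
  congr 1
  · congr 1
    refine Finset.card_bij' (fun a _ => a - t) (fun b _ => b + t) ?_ ?_ ?_ ?_
    · intro a ha
      simp only [Finset.mem_filter, Finset.mem_range] at ha ⊢
      have := Finset.mem_range.1 (hS ha.1)
      refine ⟨by lia, ha.2.2, ?_⟩
      rw [Nat.sub_add_cancel ha.2.1]; exact ha.1
    · intro b hb
      simp only [Finset.mem_filter, Finset.mem_range] at hb ⊢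
      simpa using ⟨hb.2.2, hb.2.1⟩
    · intro a ha
      simp only [Finset.mem_filter] at ha
      lia
    · intro b hb; simp
  · congr 1
    ext a
    simp only [Finset.mem_filter, Finset.mem_range]
    tauto

/-- Charge neutrality: there are `t` more addable than removable hooks of size `t`. -/
theorem hookPairs_add {t N : ℕ} {S : Finset ℕ} (hS : S ⊆ Finset.range N) :
    2 * ((Finset.range N).filter (fun b => b ∈ S ∧ b + t ∉ S)).card +
      ((Finset.range t).filter (fun a => a ∉ S ∧ t - 1 - a ∉ S)).card = hookPairs t S + t := by
  rw [hookPairs_eq hS]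
  let x : ℕ → ℤ := fun a => if a ∈ S then 1 else 0
  have e1 : (((Finset.range N).filter (fun b => b ∈ S ∧ b + t ∉ S)).card : ℤ) -
      ((Finset.range N).filter (fun b => b ∉ S ∧ b + t ∈ S)).card =
        ∑ b ∈ Finset.range N, x b - ∑ b ∈ Finset.range N, x (t + b) := by
    rw [Finset.card_filter, Finset.card_filter, Nat.cast_sum, Nat.cast_sum,
      ← Finset.sum_sub_distrib, ← Finset.sum_sub_distrib]
    refine Finset.sum_congr rfl fun b _ => ?_
    simp only [x, add_comm t b]
    by_cases h1 : b ∈ S <;> by_cases h2 : b + t ∈ S <;> simp [h1, h2]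
  have e2 : ∑ b ∈ Finset.range N, x b - ∑ b ∈ Finset.range N, x (t + b) =
      ∑ b ∈ Finset.range t, x b := by
    have h1 := Finset.sum_range_add x t N
    have h2 := Finset.sum_range_add x N t
    rw [add_comm N t] at h2
    have h3 : ∑ b ∈ Finset.range t, x (N + b) = 0 := by
      refine Finset.sum_eq_zero fun b _ => ?_
      have : N + b ∉ S := fun h => by have := Finset.mem_range.1 (hS h); lia
      simp [x, this]
    linarith
  have e3 : (((Finset.range t).filter (fun a => a ∉ S ∧ t - 1 - a ∉ S)).card : ℤ) -
      ((Finset.range t).filter (fun a => a ∈ S ∧ t - 1 - a ∈ S)).card =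
        t - 2 * ∑ b ∈ Finset.range t, x b := by
    have h1 : (t : ℤ) = ∑ b ∈ Finset.range t, (1 : ℤ) := by simp
    have h2 := Finset.sum_range_reflect x t
    rw [two_mul]
    nth_rewrite 2 [← h2]
    rw [← sub_sub, h1, Finset.card_filter, Finset.card_filter, Nat.cast_sum, Nat.cast_sum,
      ← Finset.sum_sub_distrib, ← Finset.sum_sub_distrib, ← Finset.sum_sub_distrib]
    refine Finset.sum_congr rfl fun b _ => ?_
    simp only [x]
    by_cases h1 : b ∈ S <;> by_cases h2 : t - 1 - b ∈ S <;> simp [h1, h2]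
  zify
  linarith

/-- The number of `S ∈ oddSets n` containing `(t-1)/2`, if `t` is odd. -/
def middleCount (t n : ℕ) : ℕ :=
  if Odd t then ((oddSets n).filter (fun S => t / 2 ∈ S)).card else 0

/-- The total number of hooks of size `t` over self-conjugate partitions of `n`. -/
def hookTotal (t n : ℕ) : ℕ := ∑ S ∈ oddSets n, hookPairs t S

theorem oddWeight_singleton (a : ℕ) : oddWeight {a} = 2 * a + 1 := by simp [oddWeight]

theorem middleCount_of_lt {t n : ℕ} (h : n < t) : middleCount t n = 0 := by
  unfold middleCount
  split_ifs with ht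
  · rw [Finset.card_eq_zero, Finset.filter_eq_empty_iff]
    intro S hS hm
    have := Finset.single_le_sum (f := fun a : ℕ => 2 * a + 1) (fun _ _ => Nat.zero_le _) hm
    rw [mem_oddSets, oddWeight] at hS
    obtain ⟨k, rfl⟩ := ht
    lia
  · rfl

theorem middleCount_add {t : ℕ} (ht : Odd t) (m : ℕ) :
    middleCount t (m + t) + middleCount t m = (oddSets m).card := by
  have h := card_filter_oddSets_exchange (U := {t / 2}) (V := ∅) (n := m + t) (m := m)
    (by simp) (by obtain ⟨k, rfl⟩ := ht; rw [oddWeight_singleton]; simp [oddWeight]; lia)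
  simp only [Finset.singleton_subset_iff, Finset.disjoint_empty_left, and_true,
    Finset.empty_subset, true_and, Finset.disjoint_singleton_left] at h
  unfold middleCount
  rw [if_pos ht, if_pos ht, h, add_comm, Finset.card_filter_add_card_filter_not]

theorem sum_card_filter_comm {α β : Type*} (s : Finset α) (u : Finset β) (p : α → β → Prop)
    [∀ x y, Decidable (p x y)] :
    ∑ x ∈ s, (u.filter (fun y => p x y)).card = ∑ y ∈ u, (s.filter (fun x => p x y)).card := by
  simp only [Finset.card_filter]
  exact Finset.sum_comm

theorem hookTotal_eq {t n N : ℕ} (hN : n ≤ N) :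
    hookTotal t n = 2 * ∑ b ∈ Finset.range N,
        ((oddSets n).filter (fun S => b ∉ S ∧ b + t ∈ S)).card +
      ∑ a ∈ Finset.range t, ((oddSets n).filter (fun S => a ∈ S ∧ t - 1 - a ∈ S)).card := by
  have : hookTotal t n = ∑ S ∈ oddSets n,
      (2 * ((Finset.range N).filter (fun b => b ∉ S ∧ b + t ∈ S)).card +
      ((Finset.range t).filter (fun a => a ∈ S ∧ t - 1 - a ∈ S)).card) :=
    Finset.sum_congr rfl fun S hS => hookPairs_eq
      ((subset_range_of_mem_oddSets hS).trans (Finset.range_mono hN))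
  rw [this, Finset.sum_add_distrib, ← Finset.mul_sum,
    sum_card_filter_comm _ _ (fun (S : Finset ℕ) b => b ∉ S ∧ b + t ∈ S),
    sum_card_filter_comm _ _ (fun (S : Finset ℕ) a => a ∈ S ∧ t - 1 - a ∈ S)]

theorem hookTotal_add_eq {t n N : ℕ} (hN : n ≤ N) :
    hookTotal t n + t * (oddSets n).card = 2 * ∑ b ∈ Finset.range N,
        ((oddSets n).filter (fun S => b ∈ S ∧ b + t ∉ S)).card +
      ∑ a ∈ Finset.range t, ((oddSets n).filter (fun S => a ∉ S ∧ t - 1 - a ∉ S)).card := by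
  have : hookTotal t n + t * (oddSets n).card = ∑ S ∈ oddSets n,
      (2 * ((Finset.range N).filter (fun b => b ∈ S ∧ b + t ∉ S)).card +
      ((Finset.range t).filter (fun a => a ∉ S ∧ t - 1 - a ∉ S)).card) := by
    rw [hookTotal, mul_comm, ← smul_eq_mul, ← Finset.sum_const, ← Finset.sum_add_distrib]
    exact Finset.sum_congr rfl fun S hS => (hookPairs_add
      ((subset_range_of_mem_oddSets hS).trans (Finset.range_mono hN))).symm
  rw [this, Finset.sum_add_distrib, ← Finset.mul_sum,
    sum_card_filter_comm _ _ (fun (S : Finset ℕ) b => b ∈ S ∧ b + t ∉ S),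
    sum_card_filter_comm _ _ (fun (S : Finset ℕ) a => a ∉ S ∧ t - 1 - a ∉ S)]

theorem card_filter_shift {t : ℕ} (ht : 1 ≤ t) (m b : ℕ) :
    ((oddSets (m + 2 * t)).filter (fun S => b ∉ S ∧ b + t ∈ S)).card =
      ((oddSets m).filter (fun S => b ∈ S ∧ b + t ∉ S)).card := by
  have h := card_filter_oddSets_exchange (U := {b + t}) (V := {b}) (n := m + 2 * t) (m := m)
    (by simp; lia) (by rw [oddWeight_singleton, oddWeight_singleton]; lia)
  simp only [Finset.singleton_subset_iff, Finset.disjoint_singleton_left] at h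
  simpa only [and_comm] using h

theorem card_filter_pair {t a : ℕ} (ha : a < t) (hne : 2 * a + 1 ≠ t) (m : ℕ) :
    ((oddSets (m + 2 * t)).filter (fun S => a ∈ S ∧ t - 1 - a ∈ S)).card =
      ((oddSets m).filter (fun S => a ∉ S ∧ t - 1 - a ∉ S)).card := by
  have h := card_filter_oddSets_exchange (U := {a, t - 1 - a}) (V := ∅) (n := m + 2 * t) (m := m)
    (by simp) (by
      have : a ≠ t - 1 - a := by lia
      simp [oddWeight, Finset.sum_pair this]; lia)
  simpa [Finset.insert_subset_iff] using h

theorem sum_filter_pair_eq {t : ℕ} (n : ℕ) (p : Finset ℕ → ℕ → Prop)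
    [∀ S a, Decidable (p S a)] :
    ∑ a ∈ Finset.range t, ((oddSets n).filter (fun S => p S a ∧ p S (t - 1 - a))).card =
      ∑ a ∈ (Finset.range t).filter (fun a => 2 * a + 1 ≠ t),
        ((oddSets n).filter (fun S => p S a ∧ p S (t - 1 - a))).card +
      if Odd t then ((oddSets n).filter (fun S => p S (t / 2))).card else 0 := by
  rw [← Finset.sum_filter_add_sum_filter_not _ (fun a => 2 * a + 1 ≠ t)]
  congr 1
  split_ifs with ht
  · obtain ⟨k, rfl⟩ := ht
    have : (Finset.range (2 * k + 1)).filter (fun a => ¬ (2 * a + 1 ≠ 2 * k + 1)) = {k} := by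
      ext a
      simp only [Finset.mem_filter, Finset.mem_range, Finset.mem_singleton]
      lia
    rw [this, Finset.sum_singleton]
    have h1 : 2 * k + 1 - 1 - k = k := by lia
    have h2 : (2 * k + 1) / 2 = k := by lia
    simp only [h1, h2, and_self]
  · refine Finset.sum_eq_zero fun a ha => ?_
    simp only [Finset.mem_filter, not_not] at ha
    exact absurd ⟨a, ha.2.symm⟩ ht

theorem hookTotal_add {t : ℕ} (ht : 1 ≤ t) (m : ℕ) :
    hookTotal t (m + 2 * t) + (if Odd t then (oddSets m).card else 0) =
      hookTotal t m + t * (oddSets m).card + middleCount t (m + 2 * t) + middleCount t m := by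
  have h1 := hookTotal_eq (t := t) (le_refl (m + 2 * t))
  have h2 := hookTotal_add_eq (t := t) (Nat.le_add_right m (2 * t))
  rw [sum_filter_pair_eq _ (fun S a => a ∈ S)] at h1
  rw [sum_filter_pair_eq _ (fun S a => a ∉ S)] at h2
  have h3 : ∑ a ∈ (Finset.range t).filter (fun a => 2 * a + 1 ≠ t),
        ((oddSets (m + 2 * t)).filter (fun S => a ∈ S ∧ t - 1 - a ∈ S)).card =
      ∑ a ∈ (Finset.range t).filter (fun a => 2 * a + 1 ≠ t),
        ((oddSets m).filter (fun S => a ∉ S ∧ t - 1 - a ∉ S)).card :=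
    Finset.sum_congr rfl fun a ha => by
      simp only [Finset.mem_filter, Finset.mem_range] at ha
      exact card_filter_pair ha.1 ha.2 m
  simp only [card_filter_shift ht] at h1
  rw [h3] at h1
  unfold middleCount
  split_ifs at h1 h2 ⊢ with hodd
  · have h4 := Finset.card_filter_add_card_filter_not (s := oddSets m) (fun S => t / 2 ∈ S)
    lia
  · lia

theorem hookTotal_of_lt {t n : ℕ} (h : n < 2 * t) : hookTotal t n = middleCount t n := by
  have hlt : ∀ S ∈ oddSets n, ∀ U ⊆ S, oddWeight U < 2 * t := fun S hS U hU =>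
    (Finset.sum_le_sum_of_subset hU).trans_lt ((mem_oddSets.1 hS).trans_lt h)
  rw [hookTotal_eq le_rfl, sum_filter_pair_eq _ (fun S a => a ∈ S), middleCount]
  have h1 : ∀ b, ((oddSets n).filter (fun S => b ∉ S ∧ b + t ∈ S)).card = 0 := by
    intro b
    rw [Finset.card_eq_zero, Finset.filter_eq_empty_iff]
    rintro S hS ⟨-, hb⟩
    have := hlt S hS {b + t} (by simpa using hb)
    rw [oddWeight_singleton] at this
    lia
  have h2 : ∀ a ∈ (Finset.range t).filter (fun a => 2 * a + 1 ≠ t),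
      ((oddSets n).filter (fun S => a ∈ S ∧ t - 1 - a ∈ S)).card = 0 := by
    intro a ha
    simp only [Finset.mem_filter, Finset.mem_range] at ha
    rw [Finset.card_eq_zero, Finset.filter_eq_empty_iff]
    rintro S hS ⟨hb, hc⟩
    have hne : a ≠ t - 1 - a := by lia
    have := hlt S hS {a, t - 1 - a} (by simp [Finset.insert_subset_iff, hb, hc])
    rw [oddWeight, Finset.sum_pair hne] at this
    lia
  rw [Finset.sum_eq_zero h2]
  simp [h1]

/-! ### Self-conjugate Young diagrams -/

/-- The number of elements of `S` that are at least `m`. -/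
def upperCount (S : Finset ℕ) (m : ℕ) : ℕ := (S.filter (fun a => m ≤ a)).card

theorem upperCount_eq (S : Finset ℕ) (m : ℕ) :
    upperCount S m = upperCount S (m + 1) + if m ∈ S then 1 else 0 := by
  have h : S.filter (fun a => m ≤ a) =
      S.filter (fun a => m + 1 ≤ a) ∪ S.filter (fun a => a = m) := by
    ext a
    simp only [Finset.mem_filter, Finset.mem_union]
    lia
  rw [upperCount, h, Finset.card_union_of_disjoint, ← upperCount, Finset.filter_eq']
  · split_ifs <;> simp
  · rw [Finset.disjoint_filter]
    intros
    lia

theorem upperCount_anti (S : Finset ℕ) : Antitone (upperCount S) :=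
  antitone_nat_of_succ_le fun m => by rw [upperCount_eq S m]; lia

theorem upperCount_succ_lt_iff {S : Finset ℕ} {m : ℕ} :
    upperCount S (m + 1) < upperCount S m ↔ m ∈ S := by
  rw [upperCount_eq S m]
  split_ifs with h <;> simp [h]

theorem upperCount_le_card (S : Finset ℕ) (m : ℕ) : upperCount S m ≤ S.card :=
  Finset.card_filter_le _ _

theorem le_sup_of_upperCount_pos {S : Finset ℕ} {m : ℕ} (h : 0 < upperCount S m) :
    m ≤ S.sup id := by
  obtain ⟨a, ha⟩ := Finset.card_pos.1 h
  rw [Finset.mem_filter] at ha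
  exact ha.2.trans (Finset.le_sup (f := id) ha.1)

/-- The self-conjugate Young diagram with Frobenius coordinates `(a | a)`, `a ∈ S`. -/
def symmDiagram (S : Finset ℕ) : YoungDiagram where
  cells := (Finset.range (S.card + S.sup id + 1) ×ˢ Finset.range (S.card + S.sup id + 1)).filter
    (fun c => min c.1 c.2 < upperCount S (max c.1 c.2 - min c.1 c.2))
  isLowerSet := by
    have step : ∀ m i : ℕ, i + 1 < upperCount S m → i < upperCount S (m + 1) := by
      intro m i h
      rw [upperCount_eq] at h
      split_ifs at h <;> lia
    have steps : ∀ d m i : ℕ, i + d < upperCount S m → i < upperCount S (m + d) := by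
      intro d
      induction d with
      | zero => intro m i h; simpa using h
      | succ d ih =>
        intro m i h
        rw [← add_assoc]
        exact step _ _ (ih m (i + 1) (by rwa [add_right_comm, add_assoc]))
    rintro ⟨i, k⟩ ⟨i', k'⟩ ⟨h1, h2⟩ h
    simp only [Finset.coe_filter, Finset.mem_product, Finset.mem_range, Set.mem_ofPred_eq] at h ⊢
    refine ⟨⟨by simp at h1; lia, by simp at h2; lia⟩, ?_⟩
    simp only at h1 h2
    have hmin : min i' k' ≤ min i k := min_le_min h1 h2
    have hmax : max i' k' ≤ max i k := max_le_max h1 h2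
    have := steps (min i k - min i' k') (max i k - min i k) (min i' k') (by
      rw [Nat.add_sub_cancel' hmin]; exact h.2)
    refine this.trans_le (upperCount_anti S ?_)
    have : min i k ≤ max i k := min_le_max
    lia

theorem mem_symmDiagram {S : Finset ℕ} {i k : ℕ} :
    (i, k) ∈ symmDiagram S ↔ min i k < upperCount S (max i k - min i k) := by
  rw [← YoungDiagram.mem_cells]
  simp only [symmDiagram, Finset.mem_filter, Finset.mem_product, Finset.mem_range,
    and_iff_right_iff_imp]
  intro h
  have h1 := upperCount_le_card S (max i k - min i k)
  have h2 := le_sup_of_upperCount_pos (Nat.zero_lt_of_lt h)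
  lia

theorem mem_symmDiagram_add_right {S : Finset ℕ} {i m : ℕ} :
    (i, i + m) ∈ symmDiagram S ↔ i < upperCount S m := by
  rw [mem_symmDiagram]; simp

theorem mem_symmDiagram_add_left {S : Finset ℕ} {i m : ℕ} :
    (i + m, i) ∈ symmDiagram S ↔ i < upperCount S m := by
  rw [mem_symmDiagram]; simp

theorem symmDiagram_symm {S : Finset ℕ} {i k : ℕ} :
    (i, k) ∈ symmDiagram S ↔ (k, i) ∈ symmDiagram S := by
  rw [mem_symmDiagram, mem_symmDiagram, min_comm, max_comm]

theorem symmDiagram_injective : Function.Injective symmDiagram := by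
  intro S S' h
  have : upperCount S = upperCount S' := by
    ext m
    refine eq_of_forall_lt_iff fun i => ?_
    rw [← mem_symmDiagram_add_right, ← mem_symmDiagram_add_right, h]
  ext a
  rw [← upperCount_succ_lt_iff, ← upperCount_succ_lt_iff, this]

theorem card_symmDiagram (S : Finset ℕ) : (symmDiagram S).card = oddWeight S := by
  set M : ℤ := ((S.sup id : ℕ) : ℤ) with hM
  have hmaps : ∀ c ∈ (symmDiagram S).cells, ((c.2 : ℤ) - c.1) ∈ Finset.Icc (-M) M := by
    rintro ⟨i, k⟩ h
    rw [YoungDiagram.mem_cells, mem_symmDiagram] at h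
    have h2 := le_sup_of_upperCount_pos (Nat.zero_lt_of_lt h)
    simp only [Finset.mem_Icc]
    lia
  rw [YoungDiagram.card, Finset.card_eq_sum_card_fiberwise hmaps]
  have hfib : ∀ d ∈ Finset.Icc (-M) M,
      ((symmDiagram S).cells.filter (fun c => (c.2 : ℤ) - c.1 = d)).card =
        (S.filter (fun a => d.natAbs ≤ a)).card := by
    intro d _
    rw [← upperCount, ← Finset.card_range (upperCount S d.natAbs)]
    refine Finset.card_bij' (fun c _ => min c.1 c.2)
      (fun j _ => (j + (-d).toNat, j + d.toNat)) ?_ ?_ ?_ ?_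
    · rintro ⟨i, k⟩ h
      simp only [Finset.mem_filter, YoungDiagram.mem_cells, mem_symmDiagram] at h
      rw [Finset.mem_range]
      have : max i k - min i k = d.natAbs := by lia
      rw [← this]; exact h.1
    · intro j hj
      rw [Finset.mem_range] at hj
      simp only [Finset.mem_filter, YoungDiagram.mem_cells, mem_symmDiagram]
      refine ⟨?_, by push_cast; lia⟩
      have h1 : min (j + (-d).toNat) (j + d.toNat) = j := by lia
      have h2 : max (j + (-d).toNat) (j + d.toNat) - j = d.natAbs := by lia
      rw [h1, h2]; exact hj
    · rintro ⟨i, k⟩ h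
      simp only [Finset.mem_filter] at h
      ext <;> simp only <;> lia
    · intro j _
      simp only
      lia
  rw [Finset.sum_congr rfl hfib, 
    sum_card_filter_comm _ S (fun (d : ℤ) a => d.natAbs ≤ a), oddWeight]
  refine Finset.sum_congr rfl fun a ha => ?_
  have ha' : a ≤ S.sup id := Finset.le_sup (f := id) ha
  have : (Finset.Icc (-M) M).filter (fun d => d.natAbs ≤ a) = Finset.Icc (-(a : ℤ)) a := by
    ext d
    simp only [Finset.mem_filter, Finset.mem_Icc]
    lia
  rw [this, Int.card_Icc]
  lia

theorem exists_symmDiagram_eq {μ : YoungDiagram} (hμ : ∀ i k, (i, k) ∈ μ ↔ (k, i) ∈ μ) :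
    ∃ S, symmDiagram S = μ := by
  have hcard : ∀ {i k}, (i, k) ∈ μ → i + k < μ.card := by
    intro i k h
    have hsub : Finset.range (i + 1) ×ˢ {0} ∪ {0} ×ˢ Finset.range (k + 1) ⊆ μ.cells := by
      rintro ⟨x, y⟩ hxy
      simp only [Finset.mem_union, Finset.mem_product, Finset.mem_range,
        Finset.mem_singleton] at hxy
      rw [YoungDiagram.mem_cells]
      exact μ.up_left_mem (by lia) (by lia) h
    have h1 := Finset.card_le_card hsub
    have h2 : (Finset.range (i + 1) ×ˢ ({0} : Finset ℕ)) ∩ ({0} ×ˢ Finset.range (k + 1)) =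
        {(0, 0)} := by
      ext ⟨x, y⟩
      simp only [Finset.mem_inter, Finset.mem_product, Finset.mem_range, Finset.mem_singleton,
        Prod.mk.injEq]
      lia
    have h3 := Finset.card_union_add_card_inter (Finset.range (i + 1) ×ˢ ({0} : Finset ℕ))
      ({0} ×ˢ Finset.range (k + 1))
    rw [h2] at h3
    simp only [Finset.card_product, Finset.card_range, Finset.card_singleton] at h3
    rw [YoungDiagram.card]
    lia
  have hex : ∀ m, ∃ i, (i, i + m) ∉ μ := fun m => ⟨μ.card, fun h => by have := hcard h; lia⟩
  let D : ℕ → ℕ := fun m => Nat.find (hex m)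
  have hD : ∀ i m, i < D m ↔ (i, i + m) ∈ μ := by
    intro i m
    rw [Nat.lt_find_iff]
    simp only [not_not]
    exact ⟨fun h => h i le_rfl, fun h j hj => μ.up_left_mem hj (by lia) h⟩
  have hD1 : ∀ m, D (m + 1) ≤ D m := by
    intro m
    by_contra! h
    rw [hD] at h
    exact absurd ((hD _ _).2 (μ.up_left_mem le_rfl (by lia) h)) (lt_irrefl (D m))
  have hD2 : ∀ m, D m ≤ D (m + 1) + 1 := by
    intro m
    by_contra! h
    rw [hD] at h
    exact absurd ((hD _ (m + 1)).2 (μ.up_left_mem (by lia) (by lia) h)) (lt_irrefl (D (m + 1)))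
  have hD0 : ∀ m, μ.card ≤ m → D m = 0 := by
    intro m hm
    by_contra h
    have := hcard ((hD 0 m).1 (Nat.pos_of_ne_zero h))
    lia
  let S : Finset ℕ := (Finset.range μ.card).filter (fun a => D (a + 1) < D a)
  have hS : ∀ a, a ∈ S ↔ D (a + 1) < D a := by
    intro a
    simp only [S, Finset.mem_filter, Finset.mem_range, and_iff_right_iff_imp]
    intro h
    by_contra! h'
    have := hD0 a h'
    lia
  have huD : ∀ m, upperCount S m = D m := by
    intro m
    by_cases hm : μ.card ≤ m
    · rw [hD0 m hm, upperCount, Finset.card_eq_zero, Finset.filter_eq_empty_iff]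
      intro a ha
      have := Finset.mem_range.1 (Finset.mem_filter.1 ha).1
      lia
    · refine Nat.decreasingInduction (motive := fun m _ => upperCount S m = D m) ?_ ?_
        (not_le.1 hm).le
      · intro k hk ih
        rw [upperCount_eq, ih]
        have h1 := hD1 k
        have h2 := hD2 k
        split_ifs with h <;> rw [hS] at h <;> lia
      · rw [hD0 _ le_rfl, upperCount, Finset.card_eq_zero, Finset.filter_eq_empty_iff]
        intro a ha
        have := Finset.mem_range.1 (Finset.mem_filter.1 ha).1
        lia
  refine ⟨S, ?_⟩
  have hle : ∀ i m, (i, i + m) ∈ symmDiagram S ↔ (i, i + m) ∈ μ := by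
    intro i m
    rw [mem_symmDiagram_add_right, huD, hD]
  ext ⟨i, k⟩
  rw [YoungDiagram.mem_cells, YoungDiagram.mem_cells]
  rcases le_total i k with h | h
  · obtain ⟨m, rfl⟩ := Nat.exists_eq_add_of_le h
    exact hle i m
  · obtain ⟨m, rfl⟩ := Nat.exists_eq_add_of_le h
    rw [symmDiagram_symm, hμ]
    exact hle k m

theorem mem_iff_exists_rowLen {S : Finset ℕ} {a : ℕ} :
    a ∈ S ↔ ∃ i, (symmDiagram S).rowLen i = i + a + 1 := by
  rw [← upperCount_succ_lt_iff]
  constructor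
  · intro h
    refine ⟨upperCount S (a + 1), le_antisymm ?_ ?_⟩
    · rw [← not_lt, ← YoungDiagram.mem_iff_lt_rowLen, add_assoc, mem_symmDiagram_add_right]
      exact lt_irrefl _
    · rwa [Nat.succ_le_iff, ← YoungDiagram.mem_iff_lt_rowLen, mem_symmDiagram_add_right]
  · rintro ⟨i, hi⟩
    have h1 : i < upperCount S a := by
      rw [← mem_symmDiagram_add_right, YoungDiagram.mem_iff_lt_rowLen]; lia
    have h2 : ¬ i < upperCount S (a + 1) := by
      rw [← mem_symmDiagram_add_right, YoungDiagram.mem_iff_lt_rowLen]; lia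
    lia

theorem notMem_iff_exists_rowLen {S : Finset ℕ} {b : ℕ} :
    b ∉ S ↔ ∃ k, (symmDiagram S).rowLen k + b = k := by
  have hcell : ∀ j m, j < (symmDiagram S).rowLen (j + m) ↔ j < upperCount S m := fun j m => by
    rw [← YoungDiagram.mem_iff_lt_rowLen, mem_symmDiagram_add_left]
  constructor
  · intro h
    have he := upperCount_eq S b
    rw [if_neg h, add_zero] at he
    set j := upperCount S b with hj
    refine ⟨j + b, ?_⟩
    have h1 := (hcell j b).not.2 (lt_irrefl j)
    rcases Nat.eq_zero_or_pos j with h0 | h0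
    · lia
    · have h2 := (hcell (j - 1) (b + 1)).2 (by lia)
      have h3 : j - 1 + (b + 1) = j + b := by lia
      rw [h3] at h2
      lia
  · rintro ⟨k, hk⟩ hb
    set j := (symmDiagram S).rowLen k with hj
    have he := upperCount_eq S b
    rw [if_pos hb] at he
    have h1 := hcell j b
    rw [hk, ← hj] at h1
    have h2 := hcell (j - 1) (b + 1)
    have h3 : j - 1 + (b + 1) = k := by lia
    rw [h3, ← hj] at h2
    lia

theorem YoungDiagram.eq_of_rowLen_add_eq (μ : YoungDiagram) {i j : ℕ}
    (h : μ.rowLen i + j = μ.rowLen j + i) : i = j := by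
  rcases le_total i j with hij | hij
  · have := μ.rowLen_anti i j hij
    lia
  · have := μ.rowLen_anti j i hij
    lia

theorem card_filter_hook_symmDiagram {t : ℕ} (ht : 1 ≤ t) (S : Finset ℕ) :
    ((symmDiagram S).cells.filter (fun c => (symmDiagram S).rowLen c.1 +
      (symmDiagram S).rowLen c.2 = c.1 + c.2 + 1 + t)).card = hookPairs t S := by
  set μ := symmDiagram S with hμ
  have hcell : ∀ {i k}, μ.rowLen i + μ.rowLen k = i + k + 1 + t → (i, k) ∈ μ.cells := by
    intro i k h
    rw [YoungDiagram.mem_cells]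
    by_contra hn
    have h1 : ¬ k < μ.rowLen i := by rwa [← YoungDiagram.mem_iff_lt_rowLen]
    have h2 : ¬ i < μ.rowLen k := by
      rwa [← YoungDiagram.mem_iff_lt_rowLen, symmDiagram_symm]
    lia
  set X := μ.cells.filter (fun c => μ.rowLen c.1 + μ.rowLen c.2 = c.1 + c.2 + 1 + t) with hX
  have memX : ∀ c, c ∈ X ↔ μ.rowLen c.1 + μ.rowLen c.2 = c.1 + c.2 + 1 + t := fun c => by
    simp only [hX, Finset.mem_filter, and_iff_right_iff_imp]
    exact fun h => hcell h
  have hinj : ∀ c ∈ X, ∀ c' ∈ X, μ.rowLen c.1 + c'.1 = μ.rowLen c'.1 + c.1 → c = c' := by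
    intro c hc c' hc' h
    rw [memX] at hc hc'
    have h1 := μ.eq_of_rowLen_add_eq h
    refine Prod.ext h1 (μ.eq_of_rowLen_add_eq ?_)
    lia
  have hsplit : X.card = (X.filter (fun c => μ.rowLen c.2 ≤ c.2)).card +
      ((X.filter (fun c => μ.rowLen c.1 ≤ c.1)).card +
        (X.filter (fun c => c.1 < μ.rowLen c.1 ∧ c.2 < μ.rowLen c.2)).card) := by
    rw [← Finset.card_union_of_disjoint, ← Finset.card_union_of_disjoint]
    · congr 1
      ext c
      simp only [Finset.mem_union, Finset.mem_filter]
      have := memX c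
      grind
    · rw [Finset.disjoint_left]
      intro c
      simp only [Finset.mem_union, Finset.mem_filter, memX]
      grind
    · rw [Finset.disjoint_left]
      intro c
      simp only [Finset.mem_filter, memX]
      grind
  have hswap : (X.filter (fun c => μ.rowLen c.1 ≤ c.1)).card =
      (X.filter (fun c => μ.rowLen c.2 ≤ c.2)).card := by
    refine Finset.card_bij' (fun c _ => c.swap) (fun c _ => c.swap) ?_ ?_ ?_ ?_ <;>
      intro c hc <;> simp only [Finset.mem_filter, memX, Prod.fst_swap, Prod.snd_swap,
        Prod.swap_swap] at hc ⊢ <;> lia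
  have hout : (X.filter (fun c => μ.rowLen c.2 ≤ c.2)).card =
      (S.filter (fun a => t ≤ a ∧ a - t ∉ S)).card := by
    refine Finset.card_bij (fun c _ => μ.rowLen c.1 - c.1 - 1) ?_ ?_ ?_
    · intro c hc
      simp only [Finset.mem_filter, memX] at hc ⊢
      refine ⟨mem_iff_exists_rowLen.2 ⟨c.1, by lia⟩, by lia,
        notMem_iff_exists_rowLen.2 ⟨c.2, by lia⟩⟩
    · intro c hc c' hc' h
      simp only [Finset.mem_filter] at hc hc'
      refine hinj c hc.1 c' hc'.1 ?_
      rw [memX] at hc hc'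
      lia
    · intro a ha
      simp only [Finset.mem_filter] at ha
      obtain ⟨i, hi⟩ := mem_iff_exists_rowLen.1 ha.1
      obtain ⟨k, hk⟩ := notMem_iff_exists_rowLen.1 ha.2.2
      rw [← hμ] at hi hk
      refine ⟨(i, k), ?_, by simp only; lia⟩
      simp only [Finset.mem_filter, memX]
      lia
  have hin : (X.filter (fun c => c.1 < μ.rowLen c.1 ∧ c.2 < μ.rowLen c.2)).card =
      (S.filter (fun a => a < t ∧ t - 1 - a ∈ S)).card := by
    refine Finset.card_bij (fun c _ => μ.rowLen c.1 - c.1 - 1) ?_ ?_ ?_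
    · intro c hc
      simp only [Finset.mem_filter, memX] at hc ⊢
      refine ⟨mem_iff_exists_rowLen.2 ⟨c.1, by lia⟩, by lia,
        mem_iff_exists_rowLen.2 ⟨c.2, by lia⟩⟩
    · intro c hc c' hc' h
      simp only [Finset.mem_filter] at hc hc'
      refine hinj c hc.1 c' hc'.1 ?_
      rw [memX] at hc hc'
      lia
    · intro a ha
      simp only [Finset.mem_filter] at ha
      obtain ⟨i, hi⟩ := mem_iff_exists_rowLen.1 ha.1
      obtain ⟨k, hk⟩ := mem_iff_exists_rowLen.1 ha.2.2
      rw [← hμ] at hi hk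
      refine ⟨(i, k), ?_, by simp only; lia⟩
      simp only [Finset.mem_filter, memX]
      lia
  rw [hsplit, hswap, hout, hin, hookPairs]
  ring

/-! ### From Young diagrams to partitions -/

theorem YoungDiagram.colLen_zero_ge (μ : YoungDiagram) (k : ℕ) : μ.colLen k ≤ μ.colLen 0 :=
  μ.colLen_anti 0 k (Nat.zero_le k)

theorem YoungDiagram.rowLen_le_card (μ : YoungDiagram) (i : ℕ) : μ.rowLen i ≤ μ.card := by
  rw [YoungDiagram.rowLen_eq_card, YoungDiagram.card, YoungDiagram.row]
  exact Finset.card_filter_le _ _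

theorem YoungDiagram.colLen_le_card (μ : YoungDiagram) (k : ℕ) : μ.colLen k ≤ μ.card := by
  rw [YoungDiagram.colLen_eq_card, YoungDiagram.card, YoungDiagram.col]
  exact Finset.card_filter_le _ _

theorem YoungDiagram.sum_rowLens (μ : YoungDiagram) : μ.rowLens.sum = μ.card := by
  have h : ∀ c ∈ μ.cells, c.1 ∈ Finset.range (μ.colLen 0) := by
    rintro ⟨i, k⟩ hc
    rw [Finset.mem_range, ← YoungDiagram.mem_iff_lt_colLen]
    exact μ.up_left_mem le_rfl (Nat.zero_le k) hc
  rw [YoungDiagram.card, Finset.card_eq_sum_card_fiberwise h, YoungDiagram.rowLens,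
    ← Multiset.sum_coe, ← Multiset.map_coe]
  change ∑ i ∈ Finset.range (μ.colLen 0), μ.rowLen i = _
  exact Finset.sum_congr rfl fun i _ => μ.rowLen_eq_card

/-- The partition whose parts are the row lengths of a Young diagram. -/
def partitionOfDiagram {n : ℕ} (μ : YoungDiagram) (h : μ.card = n) : n.Partition where
  parts := (μ.rowLens : Multiset ℕ)
  parts_pos := fun hi => μ.pos_of_mem_rowLens _ (Multiset.mem_coe.1 hi)
  parts_sum := by rw [Multiset.sum_coe, μ.sum_rowLens, h]

theorem colLen_partitionOfDiagram {n : ℕ} {μ : YoungDiagram} (h : μ.card = n) (k : ℕ) :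
    colLen (partitionOfDiagram μ h) (k + 1) = μ.colLen k := by
  have h1 : ((partitionOfDiagram μ h).parts) = (Finset.range (μ.colLen 0)).val.map μ.rowLen := rfl
  rw [colLen, h1, Multiset.filter_map, Multiset.card_map, ← Finset.filter_val, Finset.card_val]
  have h2 : (Finset.range (μ.colLen 0)).filter ((fun p => k + 1 ≤ p) ∘ μ.rowLen) =
      Finset.range (μ.colLen k) := by
    ext i
    simp only [Finset.mem_filter, Finset.mem_range, Function.comp, Nat.succ_le_iff]
    rw [← YoungDiagram.mem_iff_lt_rowLen, YoungDiagram.mem_iff_lt_colLen]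
    have := μ.colLen_zero_ge k
    lia
  rw [h2, Finset.card_range]

theorem rowLen_partitionOfDiagram {n : ℕ} {μ : YoungDiagram} (h : μ.card = n) (j : ℕ) :
    rowLen (partitionOfDiagram μ h) (j + 1) = μ.rowLen j := by
  rw [rowLen, ← Finset.card_range (μ.rowLen j)]
  refine Finset.card_bij' (fun k _ => k - 1) (fun k _ => k + 1) ?_ ?_ ?_ ?_
  · intro k hk
    simp only [Finset.mem_filter, Finset.mem_Icc] at hk
    obtain ⟨l, rfl⟩ := Nat.exists_eq_add_of_le' hk.1.1
    rw [colLen_partitionOfDiagram, Nat.succ_le_iff (m := j), ← YoungDiagram.mem_iff_lt_colLen,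
      YoungDiagram.mem_iff_lt_rowLen] at hk
    simpa using hk.2
  · intro k hk
    rw [Finset.mem_range] at hk
    have := μ.rowLen_le_card j
    rw [Finset.mem_filter, Finset.mem_Icc, colLen_partitionOfDiagram, Nat.succ_le_iff (m := j),
      ← YoungDiagram.mem_iff_lt_colLen, YoungDiagram.mem_iff_lt_rowLen]
    lia
  · intro k hk
    simp only [Finset.mem_filter, Finset.mem_Icc] at hk
    lia
  · intro k _
    simp

theorem partitionOfDiagram_injective {n : ℕ} {μ ν : YoungDiagram} (hμ : μ.card = n)
    (hν : ν.card = n) (h : partitionOfDiagram μ hμ = partitionOfDiagram ν hν) : μ = ν := by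
  ext ⟨i, k⟩
  rw [YoungDiagram.mem_cells, YoungDiagram.mem_cells, YoungDiagram.mem_iff_lt_colLen,
    YoungDiagram.mem_iff_lt_colLen, ← colLen_partitionOfDiagram hμ, h, colLen_partitionOfDiagram]

theorem exists_partitionOfDiagram_eq {n : ℕ} (P : n.Partition) :
    ∃ (μ : YoungDiagram) (h : μ.card = n), partitionOfDiagram μ h = P := by
  have hs : (P.parts.sort (· ≥ ·)).SortedGE := (Multiset.pairwise_sort _ _).sortedGE
  have hr := YoungDiagram.rowLens_ofRowLens_eq_self (hw := hs) (fun x hx =>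
    P.parts_pos ((Multiset.mem_sort _).1 hx))
  refine ⟨YoungDiagram.ofRowLens _ hs, ?_, ?_⟩
  · rw [← YoungDiagram.sum_rowLens, hr, ← Multiset.sum_coe, Multiset.sort_eq, P.parts_sum]
  · refine Nat.Partition.ext ?_
    change ((YoungDiagram.rowLens _ : List ℕ) : Multiset ℕ) = P.parts
    rw [hr, Multiset.sort_eq]

theorem isSelfConjugate_partitionOfDiagram {n : ℕ} {μ : YoungDiagram} (h : μ.card = n) :
    IsSelfConjugate (partitionOfDiagram μ h) ↔ ∀ i k, (i, k) ∈ μ ↔ (k, i) ∈ μ := by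
  have h1 : IsSelfConjugate (partitionOfDiagram μ h) ↔ ∀ k, μ.rowLen k = μ.colLen k := by
    refine ⟨fun H k => ?_, fun H k hk => ?_⟩
    · rw [← rowLen_partitionOfDiagram h, ← colLen_partitionOfDiagram h]
      exact H _ (Nat.le_add_left 1 k)
    · obtain ⟨l, rfl⟩ := Nat.exists_eq_add_of_le' hk
      rw [rowLen_partitionOfDiagram h, colLen_partitionOfDiagram h, H]
  rw [h1]
  constructor
  · intro H i k
    rw [YoungDiagram.mem_iff_lt_rowLen, YoungDiagram.mem_iff_lt_colLen, H]
  · intro H k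
    refine eq_of_forall_lt_iff fun i => ?_
    rw [← YoungDiagram.mem_iff_lt_rowLen, ← YoungDiagram.mem_iff_lt_colLen, H]

theorem Nhook_partitionOfDiagram {n t : ℕ} (ht : 1 ≤ t) {S : Finset ℕ}
    (h : (symmDiagram S).card = n) :
    Nhook t (partitionOfDiagram (symmDiagram S) h) = hookPairs t S := by
  rw [← card_filter_hook_symmDiagram ht, Nhook]
  have hcol : ∀ k, (symmDiagram S).colLen k = (symmDiagram S).rowLen k := fun k =>
    eq_of_forall_lt_iff fun i => by
      rw [← YoungDiagram.mem_iff_lt_rowLen, ← YoungDiagram.mem_iff_lt_colLen, symmDiagram_symm]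
  refine Finset.card_bij' (fun c _ => (c.1 - 1, c.2 - 1)) (fun c _ => (c.1 + 1, c.2 + 1))
    ?_ ?_ ?_ ?_
  · rintro ⟨i, k⟩ hc
    rw [Finset.mem_filter, Finset.mem_product, Finset.mem_Icc, Finset.mem_Icc, hookNum] at hc
    obtain ⟨i, rfl⟩ := Nat.exists_eq_add_of_le' hc.1.1.1
    obtain ⟨k, rfl⟩ := Nat.exists_eq_add_of_le' hc.1.2.1
    rw [rowLen_partitionOfDiagram, colLen_partitionOfDiagram, hcol] at hc
    simp only [Finset.mem_filter, YoungDiagram.mem_cells, YoungDiagram.mem_iff_lt_rowLen,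
      Nat.add_sub_cancel]
    push_cast at hc
    lia
  · rintro ⟨i, k⟩ hc
    simp only [Finset.mem_filter, YoungDiagram.mem_cells] at hc
    have h1 := YoungDiagram.mem_iff_lt_rowLen.1 hc.1
    have h2 := YoungDiagram.mem_iff_lt_colLen.1 hc.1
    have h3 := (symmDiagram S).rowLen_le_card i
    have h4 := (symmDiagram S).colLen_le_card k
    rw [Finset.mem_filter, Finset.mem_product, Finset.mem_Icc, Finset.mem_Icc, hookNum]
    simp only [rowLen_partitionOfDiagram, colLen_partitionOfDiagram, hcol]
    rw [hcol] at h2 h4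
    push_cast
    lia
  · rintro ⟨i, k⟩ hc
    simp only [Finset.mem_filter, Finset.mem_product, Finset.mem_Icc] at hc
    ext <;> simp only <;> lia
  · rintro ⟨i, k⟩ _
    simp

theorem sum_SC_eq {n : ℕ} (f : n.Partition → ℕ) (g : Finset ℕ → ℕ)
    (hfg : ∀ S (h : (symmDiagram S).card = n), f (partitionOfDiagram (symmDiagram S) h) = g S) :
    ∑ P ∈ SC n, f P = ∑ S ∈ oddSets n, g S := by
  symm
  have hc : ∀ S ∈ oddSets n, (symmDiagram S).card = n := fun S hS =>
    (card_symmDiagram S).trans (mem_oddSets.1 hS)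
  refine Finset.sum_bij (fun S hS => partitionOfDiagram (symmDiagram S) (hc S hS)) ?_ ?_ ?_ ?_
  · intro S hS
    simp only [SC, Finset.mem_filter, Finset.mem_univ, true_and]
    rw [isSelfConjugate_partitionOfDiagram]
    exact fun i k => symmDiagram_symm
  · intro S hS S' hS' h
    exact symmDiagram_injective (partitionOfDiagram_injective _ _ h)
  · intro P hP
    simp only [SC, Finset.mem_filter, Finset.mem_univ, true_and] at hP
    obtain ⟨μ, h, rfl⟩ := exists_partitionOfDiagram_eq P
    rw [isSelfConjugate_partitionOfDiagram] at hP
    obtain ⟨S, rfl⟩ := exists_symmDiagram_eq hP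
    exact ⟨S, mem_oddSets.2 ((card_symmDiagram S).symm.trans h), rfl⟩
  · intro S hS
    rw [hfg]

theorem card_SC (n : ℕ) : (SC n).card = (oddSets n).card := by
  rw [Finset.card_eq_sum_ones, Finset.card_eq_sum_ones]
  exact sum_SC_eq _ _ fun _ _ => rfl

theorem sum_Nhook_SC {t : ℕ} (ht : 1 ≤ t) (n : ℕ) : ∑ P ∈ SC n, Nhook t P = hookTotal t n :=
  sum_SC_eq _ _ fun _ h => Nhook_partitionOfDiagram ht h

/-! ### Generating functions -/

/-- The generating function of the numbers of self-conjugate partitions. -/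
def genFun (q : ℂ) : ℂ := ∑' n : ℕ, ((oddSets n).card : ℂ) * q ^ n

theorem summable_norm_pow_odd {q : ℂ} (hq : ‖q‖ < 1) :
    Summable fun a : ℕ => ‖q ^ (2 * a + 1)‖ := by
  simp only [norm_pow]
  exact (summable_geometric_of_lt_one (norm_nonneg q) hq).comp_injective
    (i := fun a : ℕ => 2 * a + 1) fun a b h => by simpa using h

theorem hasSum_genFun_prod {q : ℂ} (hq : ‖q‖ < 1) :
    HasSum (fun n : ℕ => ((oddSets n).card : ℂ) * q ^ n) (∏' a : ℕ, (1 + q ^ (2 * a + 1))) := by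
  have hs := summable_finsetProd_of_summable_norm (summable_norm_pow_odd hq)
  have h1 : HasSum (fun S : Finset ℕ => q ^ oddWeight S) (∏' a : ℕ, (1 + q ^ (2 * a + 1))) := by
    rw [tprod_one_add hs]
    simpa only [oddWeight, Finset.prod_pow_eq_pow_sum] using hs.hasSum
  refine ((Equiv.sigmaFiberEquiv oddWeight).hasSum_iff.2 h1).sigma fun n => ?_
  have h2 : HasSum (fun S : (oddSets n : Set (Finset ℕ)) => q ^ oddWeight S)
      (((oddSets n).card : ℂ) * q ^ n) := by
    have := (oddSets n).hasSum (fun S => q ^ oddWeight S)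
    rwa [Finset.sum_congr rfl (fun S hS => by rw [mem_oddSets.1 hS]), Finset.sum_const,
      nsmul_eq_mul] at this
  have h3 := (Equiv.subtypeEquivRight (p := fun S => oddWeight S = n)
    (q := fun S => S ∈ (oddSets n : Set (Finset ℕ)))
    (fun S => (mem_oddSets (n := n) (S := S)).symm)).hasSum_iff.2 h2
  exact h3

theorem genFun_eq_tprod {q : ℂ} (hq : ‖q‖ < 1) :
    genFun q = ∏' a : ℕ, (1 + q ^ (2 * a + 1)) :=
  (hasSum_genFun_prod hq).tsum_eq

theorem summable_genFun {q : ℂ} (hq : ‖q‖ < 1) :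
    Summable fun n : ℕ => ((oddSets n).card : ℂ) * q ^ n :=
  (hasSum_genFun_prod hq).summable

theorem card_le_oddWeight (S : Finset ℕ) : S.card ≤ oddWeight S := by
  rw [Finset.card_eq_sum_ones]
  exact Finset.sum_le_sum fun a _ => by lia

theorem hookPairs_le (t : ℕ) (S : Finset ℕ) : hookPairs t S ≤ 3 * oddWeight S := by
  have h1 := Finset.card_filter_le S (fun a => t ≤ a ∧ a - t ∉ S)
  have h2 := Finset.card_filter_le S (fun a => a < t ∧ t - 1 - a ∈ S)
  have h3 := card_le_oddWeight S
  rw [hookPairs]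
  lia

theorem hookTotal_le (t n : ℕ) : hookTotal t n ≤ 3 * n * (oddSets n).card := by
  rw [hookTotal, mul_comm, ← smul_eq_mul]
  exact Finset.sum_le_card_nsmul _ _ _ fun S hS => by
    simpa [mem_oddSets.1 hS] using hookPairs_le t S

theorem middleCount_le (t n : ℕ) : middleCount t n ≤ (oddSets n).card := by
  rw [middleCount]
  split_ifs
  · exact Finset.card_filter_le _ _
  · exact Nat.zero_le _

theorem summable_middleCount (t : ℕ) {q : ℂ} (hq : ‖q‖ < 1) :
    Summable fun n : ℕ => (middleCount t n : ℂ) * q ^ n := by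
  refine (summable_genFun hq).norm.of_norm_bounded fun n => ?_
  rw [norm_mul, norm_mul, Complex.norm_natCast, Complex.norm_natCast]
  gcongr
  exact middleCount_le t n

theorem summable_hookTotal (t : ℕ) {q : ℂ} (hq : ‖q‖ < 1) :
    Summable fun n : ℕ => (hookTotal t n : ℂ) * q ^ n := by
  obtain ⟨r, hr1, hr2⟩ := exists_between hq
  have hr0 : 0 < r := (norm_nonneg q).trans_lt hr1
  have hr : ‖(r : ℂ)‖ < 1 := by rwa [Complex.norm_real, Real.norm_of_nonneg hr0.le]
  obtain ⟨M, hM⟩ := (summable_genFun hr).norm.tendsto_atTop_zero.bddAbove_range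
  have hM' : ∀ n, ((oddSets n).card : ℝ) * r ^ n ≤ M := fun n => by
    have := hM ⟨n, rfl⟩
    simpa [abs_of_pos hr0] using this
  have hx : ‖‖q‖ / r‖ < 1 := by
    rw [Real.norm_of_nonneg (by positivity)]
    exact (div_lt_one hr0).2 hr1
  have hs := (summable_pow_mul_geometric_of_norm_lt_one 1 hx).mul_left (3 * M)
  refine hs.of_norm_bounded fun n => ?_
  rw [norm_mul, Complex.norm_natCast, norm_pow]
  have h1 : (hookTotal t n : ℝ) ≤ 3 * n * (oddSets n).card := by
    exact_mod_cast hookTotal_le t n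
  calc (hookTotal t n : ℝ) * ‖q‖ ^ n ≤ 3 * n * (oddSets n).card * ‖q‖ ^ n := by gcongr
    _ = 3 * ((oddSets n).card * r ^ n) * ((n : ℝ) ^ 1 * (‖q‖ / r) ^ n) := by
      rw [div_pow]
      field_simp
    _ ≤ 3 * M * ((n : ℝ) ^ 1 * (‖q‖ / r) ^ n) := by
      gcongr
      exact hM' n

theorem tsum_eq_pow_mul_tsum {R : ℕ → ℂ} {q : ℂ} (k : ℕ) (hs : Summable fun n => R n * q ^ n)
    (h0 : ∀ n < k, R n = 0) :
    ∑' n, R n * q ^ n = q ^ k * ∑' n, R (n + k) * q ^ n := by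
  rw [← hs.sum_add_tsum_nat_add k, Finset.sum_eq_zero, zero_add, ← tsum_mul_left]
  · exact tsum_congr fun n => by ring
  · intro n hn
    rw [h0 n (Finset.mem_range.1 hn), zero_mul]

theorem one_add_pow_ne_zero {q : ℂ} (hq : ‖q‖ < 1) {k : ℕ} (hk : k ≠ 0) : 1 + q ^ k ≠ 0 := by
  intro h
  have h1 : ‖q ^ k‖ = 1 := by rw [eq_neg_of_add_eq_zero_right h, norm_neg, norm_one]
  rw [norm_pow] at h1
  exact (pow_lt_one₀ (norm_nonneg q) hq hk).ne h1

theorem one_sub_pow_ne_zero {q : ℂ} (hq : ‖q‖ < 1) {k : ℕ} (hk : k ≠ 0) : 1 - q ^ k ≠ 0 := by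
  intro h
  have h1 : ‖q ^ k‖ = 1 := by rw [← sub_eq_zero.1 h, norm_one]
  rw [norm_pow] at h1
  exact (pow_lt_one₀ (norm_nonneg q) hq hk).ne h1

theorem tsum_middleCount {t : ℕ} (ht : Odd t) {q : ℂ} (hq : ‖q‖ < 1) :
    (1 + q ^ t) * ∑' n, (middleCount t n : ℂ) * q ^ n = q ^ t * genFun q := by
  have hU := summable_middleCount t hq
  have h : ∑' n, (middleCount t n : ℂ) * q ^ n =
      q ^ t * (genFun q - ∑' n, (middleCount t n : ℂ) * q ^ n) := by
    rw [genFun, ← (summable_genFun hq).tsum_sub hU]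
    conv_lhs => rw [tsum_eq_pow_mul_tsum t hU fun n hn => by rw [middleCount_of_lt hn, Nat.cast_zero]]
    congr 1
    refine tsum_congr fun n => ?_
    rw [← middleCount_add ht n]
    push_cast
    ring
  linear_combination h

/-- The generating function of the hook totals, divided by `genFun`. -/
def hookFactor (t : ℕ) (q : ℂ) : ℂ :=
  t * q ^ (2 * t) / (1 - q ^ (2 * t)) + (if Odd t then 1 else 0) * (q ^ t / (1 + q ^ t) ^ 2)

theorem tsum_hookTotal {t : ℕ} (ht : 1 ≤ t) {q : ℂ} (hq : ‖q‖ < 1) :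
    ∑' n, (hookTotal t n : ℂ) * q ^ n = genFun q * hookFactor t q := by
  have hU := summable_middleCount t hq
  have hT := summable_hookTotal t hq
  have hG := summable_genFun hq
  have h1 := one_add_pow_ne_zero hq (k := t) (by lia)
  have h2 := one_sub_pow_ne_zero hq (k := t) (by lia)
  set T := ∑' n, (hookTotal t n : ℂ) * q ^ n with hTd
  set U := ∑' n, (middleCount t n : ℂ) * q ^ n with hUd
  have h : T - U = q ^ (2 * t) * (T + t * genFun q + U - (if Odd t then 1 else 0) * genFun q) := by
    rw [hTd, hUd, genFun, ← hT.tsum_sub hU, ← tsum_mul_left, ← tsum_mul_left,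
      ← hT.tsum_add (hG.mul_left _), ← (hT.add (hG.mul_left _)).tsum_add hU,
      ← ((hT.add (hG.mul_left _)).add hU).tsum_sub (hG.mul_left _)]
    have hs := hT.sub hU
    simp only [← sub_mul] at hs ⊢
    rw [tsum_eq_pow_mul_tsum (2 * t) hs fun n hn => by rw [hookTotal_of_lt hn, sub_self]]
    congr 1
    refine tsum_congr fun n => ?_
    have := congrArg (Nat.cast (R := ℂ)) (hookTotal_add ht n)
    split_ifs at this ⊢ <;> push_cast at this ⊢ <;> linear_combination q ^ n * this
  have h3 : 1 - q ^ (2 * t) ≠ 0 := one_sub_pow_ne_zero hq (by lia)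
  rw [hookFactor]
  by_cases ho : Odd t
  · have hU' := tsum_middleCount ho hq
    rw [← hUd] at hU'
    simp only [ho, if_true] at h ⊢
    have h4 : 1 - q ^ (2 * t) = (1 - q ^ t) * (1 + q ^ t) := by ring
    have hU2 : U = q ^ t * genFun q / (1 + q ^ t) := by
      field_simp
      linear_combination hU'
    have h5 : T * (1 - q ^ (2 * t)) = U + q ^ (2 * t) * (t * genFun q + U - genFun q) := by
      linear_combination h
    refine mul_right_cancel₀ h3 ?_
    rw [h5, hU2, h4]
    field_simp
    ring
  · have hU0 : U = 0 := by simp [hUd, middleCount, ho]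
    simp only [ho, if_false, hU0] at h ⊢
    rw [zero_mul, add_zero, ← mul_div_assoc, eq_div_iff h3]
    linear_combination h

/-! ### The generating function in a cone -/

/-- `Li₂(-e^{-x})`. -/
def altDilog (x : ℂ) : ℂ := ∑' k : ℕ, (-1) ^ k * exp (-(k * x)) / (k : ℂ) ^ 2

/-- `log (1 + e^{-x})`. -/
def logOneAddExp (x : ℂ) : ℂ := log (1 + exp (-x))

theorem norm_exp_neg_lt_one {x : ℂ} (hx : 0 < x.re) : ‖exp (-x)‖ < 1 := by
  rw [Complex.norm_exp, Real.exp_lt_one_iff, Complex.neg_re]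
  linarith

theorem norm_altDilog_term_le {x : ℂ} (hx : 0 ≤ x.re) (k : ℕ) :
    ‖(-1) ^ k * exp (-(k * x)) / (k : ℂ) ^ 2‖ ≤ Real.exp (-x.re) * (1 / (k : ℝ) ^ 2) := by
  rcases Nat.eq_zero_or_pos k with rfl | hk
  · simp
  have hk' : (1 : ℝ) ≤ k := by exact_mod_cast hk
  rw [norm_div, norm_mul, norm_pow, norm_neg, norm_one, one_pow, one_mul, Complex.norm_exp,
    norm_pow, Complex.norm_natCast, mul_one_div]
  gcongr
  simp only [neg_re, mul_re, natCast_re, natCast_im, zero_mul, sub_zero, neg_le_neg_iff]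
  nlinarith

theorem norm_altDilog_le {x : ℂ} (hx : 0 ≤ x.re) :
    ‖altDilog x‖ ≤ Real.exp (-x.re) * (π ^ 2 / 6) := by
  exact tsum_of_norm_bounded (hasSum_zeta_two.mul_left _) (norm_altDilog_term_le hx)

theorem continuousOn_altDilog : ContinuousOn altDilog {x | 0 ≤ x.re} := by
  refine continuousOn_tsum (u := fun k : ℕ => 1 / (k : ℝ) ^ 2) (fun k => by fun_prop)
    hasSum_zeta_two.summable fun k x hx => (norm_altDilog_term_le hx k).trans ?_
  have : Real.exp (-x.re) ≤ 1 := Real.exp_le_one_iff.2 (by simpa using hx)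
  exact mul_le_of_le_one_left (by positivity) this

theorem altDilog_zero : altDilog 0 = -(π ^ 2 / 12 : ℝ) := by
  have hz := hasSum_zeta_two
  have he : HasSum (fun k : ℕ => 1 / ((2 * k : ℕ) : ℝ) ^ 2) (1 / 4 * (π ^ 2 / 6)) := by
    have hf : (fun k : ℕ => 1 / ((2 * k : ℕ) : ℝ) ^ 2) = fun k : ℕ => 1 / 4 * (1 / (k : ℝ) ^ 2) := by
      funext k
      push_cast
      rw [mul_pow, one_div_mul_one_div]
      norm_num
    rw [hf]
    exact hz.mul_left _
  have ho : Summable (fun k : ℕ => 1 / ((2 * k + 1 : ℕ) : ℝ) ^ 2) :=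
    hz.summable.comp_injective (i := fun k : ℕ => 2 * k + 1) fun a b h => by simpa using h
  have hsum : 1 / 4 * (π ^ 2 / 6) + (∑' k : ℕ, 1 / ((2 * k + 1 : ℕ) : ℝ) ^ 2) = π ^ 2 / 6 :=
    HasSum.unique (HasSum.even_add_odd (f := fun k : ℕ => 1 / (k : ℝ) ^ 2) he ho.hasSum) hz
  have ha : HasSum (fun k : ℕ => (-1) ^ k * (1 / (k : ℝ) ^ 2))
      (1 / 4 * (π ^ 2 / 6) + -(∑' k : ℕ, 1 / ((2 * k + 1 : ℕ) : ℝ) ^ 2)) := by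
    have h1 : (fun k : ℕ => (-1 : ℝ) ^ (2 * k) * (1 / ((2 * k : ℕ) : ℝ) ^ 2)) =
        fun k : ℕ => 1 / ((2 * k : ℕ) : ℝ) ^ 2 := by
      funext k
      rw [(even_two_mul k).neg_one_pow, one_mul]
    have h2 : (fun k : ℕ => (-1 : ℝ) ^ (2 * k + 1) * (1 / ((2 * k + 1 : ℕ) : ℝ) ^ 2)) =
        fun k : ℕ => -(1 / ((2 * k + 1 : ℕ) : ℝ) ^ 2) := by
      funext k
      rw [(odd_two_mul_add_one k).neg_one_pow, neg_one_mul]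
    exact HasSum.even_add_odd (f := fun k : ℕ => (-1 : ℝ) ^ k * (1 / (k : ℝ) ^ 2))
      (h1 ▸ he) (h2 ▸ ho.hasSum.neg)
  have hval : 1 / 4 * (π ^ 2 / 6) + -(∑' k : ℕ, 1 / ((2 * k + 1 : ℕ) : ℝ) ^ 2)
      = -(π ^ 2 / 12) := by linarith
  rw [hval] at ha
  have hc : HasSum (fun k : ℕ => (((-1) ^ k * (1 / (k : ℝ) ^ 2) : ℝ) : ℂ))
      ((-(π ^ 2 / 12) : ℝ) : ℂ) := Complex.hasSum_ofReal.2 ha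
  have ht : ∀ k : ℕ, (-1 : ℂ) ^ k * exp (-(k * 0)) / (k : ℂ) ^ 2 =
      (((-1) ^ k * (1 / (k : ℝ) ^ 2) : ℝ) : ℂ) := fun k => by
    push_cast
    rw [mul_zero, neg_zero, Complex.exp_zero, mul_one, mul_one_div]
  rw [altDilog, tsum_congr ht, hc.tsum_eq, Complex.ofReal_neg]

theorem hasDerivAt_altDilog {x : ℂ} (hx : 0 < x.re) :
    HasDerivAt altDilog (logOneAddExp x) x := by
  have hlog : ∑' k : ℕ, (-1) ^ (k + 1) * exp (-(k * x)) / (k : ℂ) = logOneAddExp x := by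
    have := (Complex.hasSum_taylorSeries_log (norm_exp_neg_lt_one hx)).tsum_eq
    rw [logOneAddExp, ← this]
    refine tsum_congr fun k => ?_
    rw [← Complex.exp_nat_mul, mul_neg]
  obtain ⟨ε, hε, hεx⟩ := exists_between hx
  rw [← hlog]
  refine hasDerivAt_tsum_of_isPreconnected (u := fun k : ℕ => Real.exp (-ε) ^ k)
    (g := fun (k : ℕ) (x : ℂ) => (-1 : ℂ) ^ k * exp (-(k * x)) / (k : ℂ) ^ 2)
    (g' := fun (k : ℕ) (x : ℂ) => (-1 : ℂ) ^ (k + 1) * exp (-(k * x)) / (k : ℂ))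
    (t := {y : ℂ | ε < y.re}) (y₀ := x)
    (summable_geometric_of_lt_one (Real.exp_nonneg _) (Real.exp_lt_one_iff.2 (by linarith)))
    (isOpen_lt continuous_const Complex.continuous_re)
    (convex_halfSpace_re_gt ε).isPreconnected ?_ ?_ hεx ?_ hεx
  · intro k y _
    have h1 : HasDerivAt (fun y : ℂ => exp (-(k * y))) (exp (-(k * y)) * (-(k * 1))) y :=
      HasDerivAt.cexp ((hasDerivAt_id' y).const_mul (k : ℂ)).neg
    refine ((h1.const_mul ((-1) ^ k)).div_const ((k : ℂ) ^ 2)).congr_deriv ?_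
    rcases eq_or_ne (k : ℂ) 0 with h | h
    · simp [h]
    · field_simp
      ring
  · intro k y hy
    rcases Nat.eq_zero_or_pos k with rfl | hk
    · simp
    have hk' : (1 : ℝ) ≤ k := by exact_mod_cast hk
    rw [norm_div, norm_mul, norm_pow, norm_neg, norm_one, one_pow, one_mul, Complex.norm_exp,
      Complex.norm_natCast, ← Real.exp_nat_mul]
    refine (div_le_self (Real.exp_nonneg _) hk').trans (Real.exp_le_exp.2 ?_)
    simp only [neg_re, mul_re, natCast_re, natCast_im, zero_mul, sub_zero, mul_neg,
      neg_le_neg_iff]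
    have : ε ≤ y.re := le_of_lt hy
    gcongr
  · exact (hasSum_zeta_two.summable.mul_left _).of_norm_bounded (norm_altDilog_term_le hx.le)

theorem one_add_exp_neg_mem_slitPlane {x : ℂ} (hx : 0 < x.re) :
    1 + exp (-x) ∈ slitPlane :=
  Complex.mem_slitPlane_of_norm_lt_one (norm_exp_neg_lt_one hx)

theorem hasDerivAt_logOneAddExp {x : ℂ} (hx : 0 < x.re) :
    HasDerivAt logOneAddExp (1 / (1 + exp (-x)) - 1) x := by
  have hne := Complex.slitPlane_ne_zero (one_add_exp_neg_mem_slitPlane hx)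
  have h1 : HasDerivAt (fun y : ℂ => 1 + exp (-y)) (exp (-x) * -1) x :=
    ((hasDerivAt_id x).neg.cexp).const_add 1
  refine (h1.clog (one_add_exp_neg_mem_slitPlane hx)).congr_deriv ?_
  field_simp
  ring

theorem hasDerivAt_deriv_logOneAddExp {x : ℂ} (hx : 0 < x.re) :
    HasDerivAt (fun y : ℂ => 1 / (1 + exp (-y)) - 1) (exp (-x) / (1 + exp (-x)) ^ 2) x := by
  have hne := Complex.slitPlane_ne_zero (one_add_exp_neg_mem_slitPlane hx)
  have h1 : HasDerivAt (fun y : ℂ => 1 + exp (-y)) (exp (-x) * -1) x :=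
    ((hasDerivAt_id x).neg.cexp).const_add 1
  simp only [one_div]
  refine ((h1.inv hne).sub_const 1).congr_deriv ?_
  ring

theorem half_le_norm_one_add_exp_neg {x : ℂ} (hx : |x.im| ≤ x.re) :
    1 / 2 ≤ ‖1 + exp (-x)‖ := by
  rcases le_or_gt |x.im| (π / 2) with h | h
  · have h1 : 0 ≤ Real.cos x.im := Real.cos_nonneg_of_mem_Icc (abs_le.1 h)
    have h2 := Complex.re_le_norm (1 + exp (-x))
    have h3 : (1 + exp (-x)).re = 1 + Real.exp (-x.re) * Real.cos x.im := by
      simp [Complex.exp_re]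
    have h4 : 0 ≤ Real.exp (-x.re) * Real.cos x.im := by positivity
    linarith
  · have h1 : 1 ≤ x.re := by linarith [Real.pi_gt_three]
    have h2 : ‖exp (-x)‖ ≤ 1 / 2 := by
      rw [Complex.norm_exp, Complex.neg_re, Real.exp_neg]
      have := Real.add_one_le_exp x.re
      rw [inv_le_comm₀ (Real.exp_pos _) (by norm_num)]
      linarith
    have h3 := norm_sub_norm_le (1 : ℂ) (-exp (-x))
    rw [norm_neg, norm_one, sub_neg_eq_add] at h3
    linarith

theorem norm_second_deriv_logOneAddExp_le {x : ℂ} (hx : |x.im| ≤ x.re) :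
    ‖exp (-x) / (1 + exp (-x)) ^ 2‖ ≤ 4 * Real.exp (-x.re) := by
  have h := half_le_norm_one_add_exp_neg hx
  have h2 : (1 / 4 : ℝ) ≤ ‖1 + exp (-x)‖ ^ 2 := by nlinarith
  rw [norm_div, norm_pow, Complex.norm_exp, Complex.neg_re, div_le_iff₀ (by linarith)]
  nlinarith [Real.exp_pos (-x.re)]

theorem norm_le_of_deriv_Ico (f f' : ℝ → ℂ) (C : ℝ) (hC : 0 ≤ C) (h0 : f 0 = 0)
    (hf : ∀ s ∈ Set.Ico (0 : ℝ) 1, HasDerivAt f (f' s) s)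
    (hb : ∀ s ∈ Set.Ico (0 : ℝ) 1, ‖f' s‖ ≤ C) (s : ℝ) (hs : s ∈ Set.Ico (0 : ℝ) 1) :
    ‖f s‖ ≤ C := by
  have hcont : ContinuousOn f (Set.Icc 0 s) := fun x hx =>
    (hf x ⟨hx.1, hx.2.trans_lt hs.2⟩).continuousAt.continuousWithinAt
  have := norm_image_sub_le_of_norm_deriv_right_le_segment hcont
    (fun x hx => (hf x ⟨hx.1, hx.2.trans hs.2⟩).hasDerivWithinAt)
    (fun x hx => hb x ⟨hx.1, hx.2.trans hs.2⟩) s ⟨hs.1, le_rfl⟩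
  rw [h0, sub_zero, sub_zero] at this
  exact this.trans (mul_le_of_le_one_right hC hs.2.le)

theorem norm_le_of_deriv_Icc {f f' : ℝ → ℂ} {C : ℝ} (h0 : f 0 = 0)
    (hf : ∀ s ∈ Set.Ico (0 : ℝ) 1, HasDerivAt f (f' s) s)
    (hb : ∀ s ∈ Set.Ico (0 : ℝ) 1, ‖f' s‖ ≤ C)
    (hc : ContinuousWithinAt f (Set.Icc 0 1) 1) : ‖f 1‖ ≤ C := by
  have hcont : ContinuousOn f (Set.Icc 0 1) := fun x hx => by
    rcases hx.2.eq_or_lt with h | h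
    · rwa [h]
    · exact (hf x ⟨hx.1, h⟩).continuousAt.continuousWithinAt
  have := norm_image_sub_le_of_norm_deriv_right_le_segment hcont
    (fun x hx => (hf x hx).hasDerivWithinAt) hb 1 ⟨zero_le_one, le_rfl⟩
  rwa [h0, sub_zero, sub_zero, mul_one] at this

theorem hasDerivAt_comp_line {g : ℂ → ℂ} {g' c w : ℂ} {s : ℝ}
    (hg : HasDerivAt g g' (c + s * w)) :
    HasDerivAt (fun s : ℝ => g (c + s * w)) (g' * w) s := by
  have h1 : HasDerivAt (fun s : ℝ => c + (s : ℂ) * w) w s := by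
    simpa using ((Complex.ofRealCLM.hasDerivAt (x := s)).mul_const w).const_add c
  exact HasDerivAt.comp s hg h1

theorem norm_midpoint_le {z : ℂ} (hz : 0 < z.re) (hz' : |z.im| ≤ z.re) (a : ℕ) :
    ‖altDilog (2 * (a + 1 : ℕ) * z) - altDilog (2 * a * z) -
      2 * z * logOneAddExp ((2 * a + 1 : ℕ) * z)‖ ≤ 8 * ‖z‖ ^ 3 * Real.exp (-(2 * a * z.re)) := by
  set c : ℂ := (2 * a + 1 : ℕ) * z with hc
  set M : ℝ := 4 * Real.exp (-(2 * a * z.re)) with hM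
  have hM0 : 0 ≤ M := by positivity
  have hre : ∀ s : ℝ, (c + s * z).re = (2 * a + 1 + s) * z.re := fun s => by
    simp [hc]
    ring
  have him : ∀ s : ℝ, (c + s * z).im = (2 * a + 1 + s) * z.im := fun s => by
    simp [hc]
    ring
  have hpos : ∀ s : ℝ, |s| < 1 → 0 < (c + s * z).re := fun s hs => by
    rw [hre]
    have := (abs_lt.1 hs).1
    have : (0 : ℝ) ≤ 2 * a := by positivity
    exact mul_pos (by linarith) hz
  have hcone : ∀ s : ℝ, |s| < 1 → |(c + s * z).im| ≤ (c + s * z).re := fun s hs => by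
    have := (abs_lt.1 hs).1
    have h2 : (0 : ℝ) ≤ 2 * a := by positivity
    rw [hre, him, abs_mul, abs_of_nonneg (by linarith : (0 : ℝ) ≤ 2 * a + 1 + s)]
    gcongr
    linarith
  have hsecond : ∀ s : ℝ, |s| < 1 →
      ‖exp (-(c + s * z)) / (1 + exp (-(c + s * z))) ^ 2‖ ≤ M := fun s hs => by
    refine (norm_second_deriv_logOneAddExp_le (hcone s hs)).trans ?_
    rw [hre, hM]
    gcongr
    linarith [(abs_lt.1 hs).1]
  have habs : ∀ s ∈ Set.Ico (0 : ℝ) 1, |s| < 1 ∧ |(-s)| < 1 := fun s hs => by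
    rw [abs_neg, abs_of_nonneg hs.1]
    exact ⟨hs.2, hs.2⟩
  have hneg : ∀ s : ℝ, c + s * (-z) = c + (-s : ℝ) * z := fun s => by push_cast; ring
  have hline : ∀ (g g' : ℂ → ℂ), (∀ x : ℂ, 0 < x.re → HasDerivAt g (g' x) x) →
      ∀ s ∈ Set.Ico (0 : ℝ) 1, HasDerivAt (fun s : ℝ => g (c + s * z)) (g' (c + s * z) * z) s ∧
        HasDerivAt (fun s : ℝ => g (c + s * (-z))) (g' (c + s * (-z)) * (-z)) s := by
    intro g g' hg s hs
    refine ⟨hasDerivAt_comp_line (hg _ (hpos s (habs s hs).1)),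
      hasDerivAt_comp_line (hg _ ?_)⟩
    rw [hneg]
    exact hpos _ (habs s hs).2
  have hd1 := hline _ _ fun x hx => hasDerivAt_deriv_logOneAddExp hx
  have hd2 := hline _ _ fun x hx => hasDerivAt_logOneAddExp hx
  have hd3 := hline _ _ fun x hx => hasDerivAt_altDilog hx
  have hz0 : ∀ g : ℂ → ℂ, g (c + (0 : ℝ) * z) - g (c + (0 : ℝ) * (-z)) = 0 := fun g => by simp
  have hp := norm_le_of_deriv_Ico _ _ (2 * M * ‖z‖) (by positivity)
    (hz0 fun y => 1 / (1 + exp (-y)) - 1)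
    (fun s hs => (hd1 s hs).1.sub (hd1 s hs).2) (fun s hs => by
      refine (norm_sub_le _ _).trans ?_
      rw [norm_mul, norm_mul, norm_neg, hneg]
      have h1 := mul_le_mul_of_nonneg_right (hsecond s (habs s hs).1) (norm_nonneg z)
      have h2 := mul_le_mul_of_nonneg_right (hsecond (-s) (habs s hs).2) (norm_nonneg z)
      linarith)
  have hψ := norm_le_of_deriv_Ico
    (fun s : ℝ => logOneAddExp (c + s * z) + logOneAddExp (c + s * (-z)) - 2 * logOneAddExp c)
    _ (2 * M * ‖z‖ ^ 2) (by positivity) (by simp; ring)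
    (fun s hs => ((hd2 s hs).1.add (hd2 s hs).2).sub_const _) (fun s hs => by
      have h := mul_le_mul_of_nonneg_right (hp s hs) (norm_nonneg z)
      rw [← norm_mul] at h
      refine le_trans (le_of_eq ?_) (h.trans_eq (by ring))
      congr 1
      simp only [Pi.sub_apply]
      ring)
  have hlast := norm_le_of_deriv_Icc
    (f := fun s : ℝ => altDilog (c + s * z) - altDilog (c + s * (-z)) -
      (s : ℂ) * (2 * z * logOneAddExp c)) (C := 2 * M * ‖z‖ ^ 3)
    (by simp)
    (fun s hs => ((hd3 s hs).1.sub (hd3 s hs).2).sub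
      ((Complex.ofRealCLM.hasDerivAt (x := s)).mul_const _)) (fun s hs => by
      have h := mul_le_mul_of_nonneg_right (hψ s hs) (norm_nonneg z)
      rw [← norm_mul] at h
      refine le_trans (le_of_eq ?_) (h.trans_eq (by ring))
      congr 1
      simp
      ring) (by
      have hL : ∀ w : ℂ, (w = z ∨ w = -z) →
          ContinuousWithinAt (fun s : ℝ => altDilog (c + s * w)) (Set.Icc 0 1) 1 := by
        intro w hw
        have hmaps : Set.MapsTo (fun s : ℝ => c + s * w) (Set.Icc 0 1) {x : ℂ | 0 ≤ x.re} := by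
          intro s hs
          have h2 : (0 : ℝ) ≤ 2 * a := by positivity
          rcases hw with rfl | rfl
          · change 0 ≤ (c + s * w).re
            rw [hre]
            exact mul_nonneg (by linarith [hs.1]) hz.le
          · change 0 ≤ (c + s * (-z)).re
            rw [hneg, hre]
            exact mul_nonneg (by linarith [hs.2]) hz.le
        exact (continuousOn_altDilog.comp (by fun_prop) hmaps) 1 ⟨zero_le_one, le_rfl⟩
      exact ((hL z (Or.inl rfl)).sub (hL (-z) (Or.inr rfl))).sub (by fun_prop))
  have e1 : c + (1 : ℝ) * z = 2 * (a + 1 : ℕ) * z := by rw [hc]; push_cast; ring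
  have e2 : c + (1 : ℝ) * (-z) = 2 * a * z := by rw [hc]; push_cast; ring
  rw [e1, e2, Complex.ofReal_one, one_mul] at hlast
  exact hlast.trans_eq (by rw [hM]; ring)

theorem hasSum_logOneAddExp {z : ℂ} (hz : 0 < z.re) :
    Summable (fun a : ℕ => logOneAddExp ((2 * a + 1 : ℕ) * z)) ∧
      exp (∑' a : ℕ, logOneAddExp ((2 * a + 1 : ℕ) * z)) = genFun (exp (-z)) := by
  have hq := norm_exp_neg_lt_one hz
  have hpow : ∀ a : ℕ, exp (-((2 * a + 1 : ℕ) * z)) = exp (-z) ^ (2 * a + 1) := fun a => by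
    rw [← Complex.exp_nat_mul, mul_neg]
  have hs := Complex.summable_log_one_add_of_summable (summable_norm_pow_odd hq).of_norm
  simp only [logOneAddExp, hpow]
  refine ⟨hs, ?_⟩
  rw [genFun_eq_tprod hq]
  exact Complex.cexp_tsum_eq_tprod (fun a => one_add_pow_ne_zero hq (by lia)) hs

theorem norm_le_two_mul_re {z : ℂ} (hz : |z.im| ≤ z.re) : ‖z‖ ≤ 2 * z.re := by
  have := Complex.norm_le_abs_re_add_abs_im z
  rw [abs_of_nonneg ((abs_nonneg _).trans hz)] at this
  linarith

/-- In the cone `|Im z| ≤ Re z`, the generating function is `exp (π² / (24 z) + O(z))`. -/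
theorem exists_genFun_eq_exp {z : ℂ} (hz : 0 < z.re) (hz' : |z.im| ≤ z.re) (hz1 : z.re ≤ 1) :
    ∃ w : ℂ, ‖w‖ ≤ 12 * ‖z‖ ∧ genFun (exp (-z)) = exp ((π ^ 2 / 24 : ℝ) / z + w) := by
  obtain ⟨hs, hexp⟩ := hasSum_logOneAddExp hz
  have hz0 : z ≠ 0 := fun h => by simp [h] at hz
  have hzn : 0 < ‖z‖ := norm_pos_iff.2 hz0
  set g := ∑' a : ℕ, logOneAddExp ((2 * a + 1 : ℕ) * z) with hg
  refine ⟨g - (π ^ 2 / 24 : ℝ) / z, ?_, by rw [← hexp]; congr 1; ring⟩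
  set r := Real.exp (-(2 * z.re)) with hr
  have hr1 : r < 1 := Real.exp_lt_one_iff.2 (by linarith)
  have hgeo := hasSum_geometric_of_lt_one (Real.exp_nonneg _) hr1
  have hrpow : ∀ a : ℕ, Real.exp (-(2 * a * z.re)) = r ^ a := fun a => by
    rw [hr, ← Real.exp_nat_mul]
    congr 1
    ring
  have hD : ∀ a : ℕ, ‖altDilog (2 * (a + 1 : ℕ) * z) - altDilog (2 * a * z) -
      2 * z * logOneAddExp ((2 * a + 1 : ℕ) * z)‖ ≤ 8 * ‖z‖ ^ 3 * r ^ a := fun a =>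
    (norm_midpoint_le hz hz' a).trans_eq (by rw [hrpow])
  have hDs := (hgeo.summable.mul_left (8 * ‖z‖ ^ 3)).of_norm_bounded hD
  have hbound := tsum_of_norm_bounded (hgeo.mul_left (8 * ‖z‖ ^ 3)) hD
  have htel : HasSum (fun a : ℕ => altDilog (2 * (a + 1 : ℕ) * z) - altDilog (2 * a * z))
      (-altDilog 0) := by
    have hsum : Summable fun a : ℕ => altDilog (2 * (a + 1 : ℕ) * z) - altDilog (2 * a * z) := by
      simpa using hDs.add (hs.mul_left (2 * z))
    have hlim : Tendsto (fun N : ℕ => altDilog (2 * N * z)) atTop (nhds 0) := by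
      refine squeeze_zero_norm (a := fun N => r ^ N * (π ^ 2 / 6)) (fun N => ?_) ?_
      · have h1 : (2 * N * z : ℂ).re = 2 * N * z.re := by simp
        refine (norm_altDilog_le (by rw [h1]; positivity)).trans_eq ?_
        rw [h1, hrpow]
      · simpa using (tendsto_pow_atTop_nhds_zero_of_lt_one (Real.exp_nonneg _) hr1).mul_const
          (π ^ 2 / 6)
    have h2 := hsum.hasSum.tendsto_sum_nat
    simp only [Finset.sum_range_sub (fun a : ℕ => altDilog (2 * a * z))] at h2
    have h3 := tendsto_nhds_unique h2 (by simpa using hlim.sub_const (altDilog 0))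
    rw [← h3]
    exact hsum.hasSum
  rw [(htel.sub (hs.hasSum.mul_left (2 * z))).tsum_eq, altDilog_zero, ← hg] at hbound
  have hkey : (-(-((π ^ 2 / 12 : ℝ) : ℂ)) - 2 * z * g) = -(2 * z) * (g - (π ^ 2 / 24 : ℝ) / z) := by
    push_cast
    field_simp
    ring
  rw [hkey, norm_mul, norm_neg, norm_mul, RCLike.norm_ofNat] at hbound
  have h1r : 2 * z.re / 3 ≤ 1 - r := by
    have h1 := Real.add_one_le_exp (2 * z.re)
    rw [hr, Real.exp_neg]
    have h2 : (Real.exp (2 * z.re))⁻¹ ≤ (2 * z.re + 1)⁻¹ := by gcongr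
    have h3 : (2 * z.re + 1)⁻¹ ≤ 1 - 2 * z.re / 3 := by
      rw [inv_le_iff_one_le_mul₀ (by linarith)]
      nlinarith
    linarith
  have h2z := norm_le_two_mul_re hz'
  have h3 : 8 * ‖z‖ ^ 3 * (1 - r)⁻¹ ≤ 24 * ‖z‖ ^ 2 := by
    rw [← div_eq_mul_inv, div_le_iff₀ (by linarith)]
    have : ‖z‖ ≤ 3 * (1 - r) := by linarith
    nlinarith [mul_le_mul_of_nonneg_left this (by positivity : (0 : ℝ) ≤ 8 * ‖z‖ ^ 2)]
  have h4 : 2 * ‖z‖ * ‖g - (π ^ 2 / 24 : ℝ) / z‖ ≤ 2 * ‖z‖ * (12 * ‖z‖) :=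
    (hbound.trans h3).trans_eq (by ring)
  exact le_of_mul_le_mul_left h4 (by positivity)

/-! ### The generating function away from the cone -/

theorem norm_one_add_le_mul_exp {w : ℂ} (hw : ‖w‖ ≤ 1) :
    ‖1 + w‖ ≤ (1 + ‖w‖) * Real.exp (-(‖w‖ - w.re) / 4) := by
  have hn := norm_nonneg w
  have hre := Complex.re_le_norm w
  refine le_of_sq_le_sq ?_ (by positivity)
  have h1 : ‖1 + w‖ ^ 2 = (1 + ‖w‖) ^ 2 - 2 * (‖w‖ - w.re) := by
    rw [← Complex.normSq_eq_norm_sq, Complex.normSq_add, map_one, Complex.normSq_eq_norm_sq]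
    simp
    ring
  have h2 : 1 - (‖w‖ - w.re) / 2 ≤ Real.exp (-(‖w‖ - w.re) / 4) ^ 2 := by
    rw [← Real.exp_nat_mul]
    have := Real.add_one_le_exp ((2 : ℕ) * (-(‖w‖ - w.re) / 4))
    push_cast at this ⊢
    linarith
  rw [h1, mul_pow]
  have h3 := mul_le_mul_of_nonneg_left h2 (by positivity : 0 ≤ (1 + ‖w‖) ^ 2)
  have h4 : (1 + ‖w‖) ^ 2 ≤ 4 := by nlinarith
  nlinarith

theorem hasSum_pow_odd {q : ℂ} (hq : ‖q‖ < 1) :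
    HasSum (fun a : ℕ => q ^ (2 * a + 1)) (q / (1 - q ^ 2)) := by
  have h : ‖q ^ 2‖ < 1 := by
    rw [norm_pow]
    exact pow_lt_one₀ (norm_nonneg q) hq two_ne_zero
  have := (hasSum_geometric_of_norm_lt_one h).mul_left q
  simpa only [← pow_mul, ← pow_succ', div_eq_mul_inv] using this

theorem norm_genFun_le_mul_exp {q : ℂ} (hq : ‖q‖ < 1) :
    ‖genFun q‖ ≤ ‖genFun (‖q‖ : ℝ)‖ *
      Real.exp (-(‖q‖ / (1 - ‖q‖ ^ 2) - (q / (1 - q ^ 2)).re) / 4) := by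
  have hρ : ‖((‖q‖ : ℝ) : ℂ)‖ < 1 := by simpa using hq
  have hP : ∀ {p : ℂ}, ‖p‖ < 1 → Tendsto (fun N => ∏ a ∈ Finset.range N, ‖1 + p ^ (2 * a + 1)‖)
      atTop (nhds ‖genFun p‖) := fun {p} hp => by
    have hm := multipliable_one_add_of_summable (summable_norm_pow_odd hp)
    have := hm.hasProd.tendsto_prod_nat.norm
    rw [← genFun_eq_tprod hp] at this
    simpa only [norm_prod] using this
  have hS : HasSum (fun a : ℕ => -(‖q‖ ^ (2 * a + 1) - (q ^ (2 * a + 1)).re) / 4)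
      (-(‖q‖ / (1 - ‖q‖ ^ 2) - (q / (1 - q ^ 2)).re) / 4) := by
    refine (HasSum.sub ?_ (Complex.hasSum_re (hasSum_pow_odd hq))).neg.div_const 4
    have := Complex.hasSum_re (hasSum_pow_odd hρ)
    norm_cast at this
  refine le_of_tendsto_of_tendsto' (hP hq)
    ((hP hρ).mul ((Real.continuous_exp.tendsto _).comp hS.tendsto_sum_nat)) fun N => ?_
  simp only [Function.comp_apply]
  rw [Real.exp_sum, ← Finset.prod_mul_distrib]
  refine Finset.prod_le_prod (fun _ _ => norm_nonneg _) fun a _ => ?_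
  have hle : ‖q ^ (2 * a + 1)‖ ≤ 1 := by
    rw [norm_pow]
    exact pow_le_one₀ (norm_nonneg q) hq.le
  refine (norm_one_add_le_mul_exp hle).trans_eq ?_
  have hpos : (0 : ℝ) ≤ 1 + ‖q‖ ^ (2 * a + 1) := by positivity
  rw [norm_pow, ← Complex.ofReal_pow, ← Complex.ofReal_one, ← Complex.ofReal_add,
    Complex.norm_of_nonneg hpos]

theorem re_div_one_sub_sq (q : ℂ) :
    (q / (1 - q ^ 2)).re =
      q.re * (1 - ‖q‖ ^ 2) / ((1 - ‖q‖ ^ 2) ^ 2 + 4 * q.im ^ 2) := by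
  have h : Complex.normSq (1 - q ^ 2) = (1 - ‖q‖ ^ 2) ^ 2 + 4 * q.im ^ 2 := by
    rw [← Complex.normSq_eq_norm_sq, Complex.normSq_apply, Complex.normSq_apply]
    simp [pow_two]
    ring
  rw [Complex.div_re, h, ← add_div, ← Complex.normSq_eq_norm_sq, Complex.normSq_apply]
  congr 1
  simp [pow_two]
  ring

theorem norm_genFun_minor_arc {τ θ : ℝ} (hτ : 0 < τ) (hτ1 : τ ≤ 1) (h1 : τ ≤ |θ|)
    (h2 : |θ| ≤ π) :
    ‖genFun (exp (-(τ + θ * I)))‖ ≤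
      ‖genFun (exp (-(τ : ℂ)))‖ * Real.exp (-(1 / (1000 * τ))) := by
  set q := exp (-(τ + θ * I)) with hqd
  set ρ := Real.exp (-τ) with hρd
  have hq : ‖q‖ = ρ := by rw [hqd, Complex.norm_exp]; simp [hρd]
  have hρ1 : ρ < 1 := Real.exp_lt_one_iff.2 (by linarith)
  have hρ0 : 0 < ρ := Real.exp_pos _
  have hre : q.re = ρ * Real.cos θ := by rw [hqd, Complex.exp_re]; simp [hρd]
  have him : q.im = -(ρ * Real.sin θ) := by rw [hqd, Complex.exp_im]; simp [hρd]
  have hmain := norm_genFun_le_mul_exp (q := q) (hq ▸ hρ1)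
  rw [hq] at hmain
  have hcast : ((ρ : ℝ) : ℂ) = exp (-(τ : ℂ)) := by rw [hρd]; push_cast; rfl
  rw [hcast] at hmain
  refine hmain.trans ?_
  gcongr ?_ * Real.exp ?_
  have hρ3 : 1 / 3 ≤ ρ := by
    have : Real.exp (-1) ≤ ρ := Real.exp_le_exp.2 (by linarith)
    refine le_trans ?_ this
    rw [Real.exp_neg, one_div]
    have := Real.exp_one_lt_d9
    gcongr
    linarith
  have hv0 : 0 < 1 - ρ ^ 2 := by nlinarith
  have hv1 : 1 - ρ ^ 2 ≤ 2 * τ := by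
    have := Real.add_one_le_exp (-(2 * τ))
    have h3 : ρ ^ 2 = Real.exp (-(2 * τ)) := by rw [hρd, ← Real.exp_nat_mul]; congr 1; push_cast; ring
    linarith
  have hbase : 1 / (6 * τ) ≤ ρ / (1 - ρ ^ 2) := by
    rw [div_le_div_iff₀ (by positivity) hv0]
    nlinarith
  have hfrac : (q / (1 - q ^ 2)).re ≤ 40 / 41 * (ρ / (1 - ρ ^ 2)) := by
    rw [re_div_one_sub_sq, hq, hre, him]
    rcases le_or_gt (Real.cos θ) 0 with hc | hc
    · refine le_trans ?_ (by positivity : 0 ≤ 40 / 41 * (ρ / (1 - ρ ^ 2)))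
      refine div_nonpos_of_nonpos_of_nonneg ?_ (by positivity)
      exact mul_nonpos_of_nonpos_of_nonneg (mul_nonpos_of_nonneg_of_nonpos hρ0.le hc) hv0.le
    · have hθ : |θ| ≤ π / 2 := by
        by_contra! h
        have := Real.cos_nonpos_of_pi_div_two_le_of_le h.le (by linarith [Real.pi_pos])
        rw [Real.cos_abs] at this
        linarith
      have hsin : 2 / π * |θ| ≤ Real.sin |θ| := Real.mul_le_sin (abs_nonneg θ) hθ
      have hsin2 : τ / 2 ≤ Real.sin |θ| := by
        refine le_trans ?_ hsin
        have : 1 / 2 ≤ 2 / π := by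
          rw [div_le_div_iff₀ two_pos Real.pi_pos]
          linarith [Real.pi_le_four]
        nlinarith
      have hs2 : Real.sin θ ^ 2 = Real.sin |θ| ^ 2 := by
        rcases abs_choice θ with h | h <;> rw [h]
        rw [Real.sin_neg, neg_sq]
      have hs3 : τ ^ 2 / 4 ≤ Real.sin θ ^ 2 := by
        rw [hs2]
        nlinarith
      have hρsq : 1 / 9 ≤ ρ ^ 2 := by nlinarith
      have hv2 : (1 - ρ ^ 2) ^ 2 ≤ 4 * τ ^ 2 := by nlinarith
      have hD : (1 - ρ ^ 2) ^ 2 * (1 + 1 / 40) ≤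
          (1 - ρ ^ 2) ^ 2 + 4 * (-(ρ * Real.sin θ)) ^ 2 := by
        have : 1 / 9 * (τ ^ 2 / 4) ≤ ρ ^ 2 * Real.sin θ ^ 2 := by gcongr
        nlinarith
      have hnum : ρ * Real.cos θ * (1 - ρ ^ 2) ≤ ρ * (1 - ρ ^ 2) := by
        have := Real.cos_le_one θ
        gcongr
        exact mul_le_of_le_one_right hρ0.le this
      calc ρ * Real.cos θ * (1 - ρ ^ 2) / ((1 - ρ ^ 2) ^ 2 + 4 * (-(ρ * Real.sin θ)) ^ 2)
          ≤ ρ * (1 - ρ ^ 2) / ((1 - ρ ^ 2) ^ 2 * (1 + 1 / 40)) := by gcongr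
        _ = 40 / 41 * (ρ / (1 - ρ ^ 2)) := by
          field_simp
          norm_num
  have hfin : 1 / (1000 * τ) ≤ 1 / (6 * τ) / 41 / 4 := by
    rw [div_div, div_div]
    gcongr 1 / ?_
    linarith
  linarith

/-! ### Coefficient extraction -/

theorem norm_exp_neg_add_mul_I (τ θ : ℝ) : ‖exp (-(τ + θ * I))‖ = Real.exp (-τ) := by
  rw [Complex.norm_exp]
  simp

theorem norm_exp_ofReal_neg (τ : ℝ) : ‖exp (-(τ : ℂ))‖ = Real.exp (-τ) := by
  rw [Complex.norm_exp]
  simp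

theorem continuous_tsum_mul_exp_pow {R : ℕ → ℂ} {τ : ℝ}
    (hR : Summable fun k => R k * exp (-(τ : ℂ)) ^ k) :
    Continuous fun θ : ℝ => ∑' k, R k * exp (-(τ + θ * I)) ^ k := by
  refine continuous_tsum (fun k => by fun_prop) hR.norm fun k θ => le_of_eq ?_
  rw [norm_mul, norm_mul, norm_pow, norm_pow, norm_exp_neg_add_mul_I, norm_exp_ofReal_neg]

theorem integral_exp_int_mul_I {m : ℤ} (hm : m ≠ 0) :
    ∫ θ in -π..π, exp (m * I * (θ : ℂ)) = 0 := by
  have hm' : (m : ℂ) * I ≠ 0 := mul_ne_zero (Int.cast_ne_zero.2 hm) I_ne_zero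
  rw [integral_exp_mul_complex hm', div_eq_zero_iff, sub_eq_zero]
  refine Or.inl (Complex.exp_eq_exp_iff_exists_int.2 ⟨m, ?_⟩)
  push_cast
  ring

theorem integral_tsum_mul_exp {R : ℕ → ℂ} {τ : ℝ}
    (hR : Summable fun k => R k * exp (-(τ : ℂ)) ^ k) (n : ℕ) :
    ∫ θ in -π..π, (∑' k, R k * exp (-(τ + θ * I)) ^ k) * exp (n * (τ + θ * I)) =
      2 * π * R n := by
  have hterm : ∀ (k : ℕ) (θ : ℝ), R k * exp (-(τ + θ * I)) ^ k * exp (n * (τ + θ * I)) =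
      R k * exp (((n : ℤ) - k : ℤ) * (τ : ℂ)) * exp (((n : ℤ) - k : ℤ) * I * (θ : ℂ)) := by
    intro k θ
    rw [← Complex.exp_nat_mul, mul_assoc, mul_assoc, ← Complex.exp_add, ← Complex.exp_add]
    congr 2
    push_cast
    ring
  have hnorm : ∀ (k : ℕ) (θ : ℝ), ‖R k * exp (-(τ + θ * I)) ^ k‖ =
      ‖R k * exp (-(τ : ℂ)) ^ k‖ := fun k θ => by
    rw [norm_mul, norm_mul, norm_pow, norm_pow, norm_exp_neg_add_mul_I, norm_exp_ofReal_neg]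
  have hnorm2 : ∀ θ : ℝ, ‖exp (n * (τ + θ * I))‖ = Real.exp (n * τ) := fun θ => by
    rw [Complex.norm_exp]
    simp
  have h := intervalIntegral.hasSum_integral_of_dominated_convergence
    (μ := MeasureTheory.volume) (a := -π) (b := π)
    (F := fun (k : ℕ) (θ : ℝ) => R k * exp (-(τ + θ * I)) ^ k * exp (n * (τ + θ * I)))
    (f := fun θ : ℝ => (∑' k, R k * exp (-(τ + θ * I)) ^ k) * exp (n * (τ + θ * I)))
    (fun k _ => ‖R k * exp (-(τ : ℂ)) ^ k‖ * Real.exp (n * τ))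
    (fun k => by
      refine Continuous.aestronglyMeasurable ?_
      fun_prop)
    (fun k => Eventually.of_forall fun θ _ => by rw [norm_mul, hnorm, hnorm2])
    (Eventually.of_forall fun θ _ => hR.norm.mul_right _)
    intervalIntegrable_const
    (Eventually.of_forall fun θ _ => by
      refine HasSum.mul_right _ (Summable.hasSum ?_)
      exact hR.norm.of_norm_bounded fun k => (hnorm k θ).le)
  refine h.unique ?_
  have hval : ∀ k : ℕ, ∫ θ in -π..π, R k * exp (-(τ + θ * I)) ^ k * exp (n * (τ + θ * I)) =
      if k = n then 2 * π * R n else 0 := by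
    intro k
    simp only [hterm]
    rw [intervalIntegral.integral_const_mul]
    split_ifs with hk
    · subst hk
      simp
      ring
    · rw [integral_exp_int_mul_I (by lia), mul_zero]
  simp only [hval]
  exact hasSum_ite_eq n _

/-! ### The saddle point integral -/

/-- The exponential of the phase near the saddle point, in rescaled variables. -/
def saddle (A σ s : ℝ) : ℂ := exp (-(A * s ^ 2) / (1 + σ * s * I))

theorem one_add_mul_I_ne_zero (σ s : ℝ) : (1 + σ * s * I : ℂ) ≠ 0 := fun h => by
  have := congrArg Complex.re h
  simp at this

theorem two_add_mul_I_ne_zero (σ s : ℝ) : (2 + σ * s * I : ℂ) ≠ 0 := fun h => by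
  have := congrArg Complex.re h
  simp at this

theorem continuous_saddle (A σ : ℝ) : Continuous (saddle A σ) := by
  unfold saddle
  refine Complex.continuous_exp.comp (Continuous.div (by fun_prop) (by fun_prop) fun s => ?_)
  exact one_add_mul_I_ne_zero σ s

theorem abs_mul_le_one {σ s : ℝ} (hσ : 0 < σ) (hs : |s| ≤ 1 / σ) : |σ * s| ≤ 1 := by
  rw [abs_mul, abs_of_pos hσ, mul_comm]
  exact (le_div_iff₀ hσ).1 hs

theorem norm_saddle_le {A σ s : ℝ} (hA : 0 < A) (hσ : 0 < σ) (hs : |s| ≤ 1 / σ) :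
    ‖saddle A σ s‖ ≤ Real.exp (-(A / 2) * s ^ 2) := by
  rw [saddle, Complex.norm_exp]
  refine Real.exp_le_exp.2 ?_
  have h1 : (σ * s) ^ 2 ≤ 1 := (sq_le_one_iff_abs_le_one _).2 (abs_mul_le_one hσ hs)
  have h2 : (-(A * s ^ 2 : ℂ) / (1 + σ * s * I)).re = -(A * s ^ 2) / (1 + (σ * s) ^ 2) := by
    rw [Complex.div_re, Complex.normSq_apply]
    simp [← Complex.ofReal_pow]
    ring
  rw [h2, div_le_iff₀ (by positivity)]
  nlinarith [mul_nonneg hA.le (sq_nonneg s)]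

theorem tendsto_integral_mul_saddle {A : ℝ} (hA : 0 < A) {f : ℝ → ℝ → ℂ} {f₀ : ℂ} {C : ℝ}
    (hf : ∀ σ, 0 < σ → Continuous (f σ))
    (hb : ∀ᶠ σ in nhdsWithin (0 : ℝ) (Set.Ioi 0), ∀ s, |s| ≤ 1 / σ → ‖f σ s‖ ≤ C * (1 + |s|))
    (hl : ∀ s, Tendsto (fun σ => f σ s) (nhdsWithin (0 : ℝ) (Set.Ioi 0)) (nhds f₀)) :
    Tendsto (fun σ : ℝ => ∫ s in -(1 / σ)..1 / σ, f σ s * saddle A σ s)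
      (nhdsWithin (0 : ℝ) (Set.Ioi 0)) (nhds (f₀ * √(π / A))) := by
  have hpos : ∀ᶠ σ in nhdsWithin (0 : ℝ) (Set.Ioi 0), 0 < σ := self_mem_nhdsWithin
  have hgauss : ∫ s : ℝ, f₀ * (Real.exp (-A * s ^ 2) : ℂ) = f₀ * √(π / A) := by
    rw [MeasureTheory.integral_const_mul, integral_complex_ofReal, integral_gaussian]
  rw [← hgauss]
  have heq : (fun σ : ℝ => ∫ s, (Set.Ioc (-(1 / σ)) (1 / σ)).indicator
      (fun s => f σ s * saddle A σ s) s) =ᶠ[nhdsWithin (0 : ℝ) (Set.Ioi 0)]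
      fun σ : ℝ => ∫ s in -(1 / σ)..1 / σ, f σ s * saddle A σ s := by
    filter_upwards [hpos] with σ hσ
    rw [MeasureTheory.integral_indicator measurableSet_Ioc, intervalIntegral.integral_of_le]
    have : 0 < 1 / σ := by positivity
    linarith
  refine Tendsto.congr' heq ?_
  have hA2 : 0 < A / 2 := by positivity
  refine MeasureTheory.tendsto_integral_filter_of_dominated_convergence
    (fun s => C * (Real.exp (-(A / 2) * s ^ 2) + ‖s * Real.exp (-(A / 2) * s ^ 2)‖)) ?_ ?_ ?_ ?_
  · filter_upwards [hpos] with σ hσ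
    exact (((hf σ hσ).mul (continuous_saddle A σ)).aestronglyMeasurable).indicator
      measurableSet_Ioc
  · filter_upwards [hpos, hb] with σ hσ hbσ
    refine Eventually.of_forall fun s => ?_
    have hC : 0 ≤ C := by
      have h0 := hbσ 0 (by rw [abs_zero]; positivity)
      rw [abs_zero, add_zero, mul_one] at h0
      exact (norm_nonneg _).trans h0
    by_cases hs : s ∈ Set.Ioc (-(1 / σ)) (1 / σ)
    · have hs' : |s| ≤ 1 / σ := abs_le.2 ⟨hs.1.le, hs.2⟩
      rw [Set.indicator_of_mem hs, norm_mul, norm_mul, Real.norm_of_nonneg (Real.exp_nonneg _),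
        Real.norm_eq_abs]
      have := mul_le_mul (hbσ s hs') (norm_saddle_le hA hσ hs') (norm_nonneg _) (by positivity)
      exact this.trans_eq (by ring)
    · rw [Set.indicator_of_notMem hs, norm_zero]
      positivity
  · exact ((integrable_exp_neg_mul_sq hA2).add (integrable_mul_exp_neg_mul_sq hA2).norm).const_mul _
  · refine Eventually.of_forall fun s => ?_
    have hsad : Tendsto (fun σ : ℝ => saddle A σ s) (nhdsWithin (0 : ℝ) (Set.Ioi 0))
        (nhds (Real.exp (-A * s ^ 2) : ℂ)) := by
      have hc : ContinuousAt (fun σ : ℝ => saddle A σ s) 0 := by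
        unfold saddle
        refine ContinuousAt.cexp (ContinuousAt.div (by fun_prop) (by fun_prop) ?_)
        exact one_add_mul_I_ne_zero 0 s
      have h0 : saddle A 0 s = (Real.exp (-A * s ^ 2) : ℂ) := by
        rw [saddle]
        push_cast
        simp
      rw [← h0]
      exact hc.tendsto.mono_left nhdsWithin_le_nhds
    refine Tendsto.congr' ?_ ((hl s).mul hsad)
    have hinv : ∀ᶠ σ in nhdsWithin (0 : ℝ) (Set.Ioi 0), |s| + 1 ≤ 1 / σ := by
      simp only [one_div]
      exact tendsto_inv_nhdsGT_zero.eventually_ge_atTop _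
    filter_upwards [hinv] with σ hσ
    rw [Set.indicator_of_mem]
    exact ⟨by linarith [neg_abs_le s], by linarith [le_abs_self s]⟩

theorem hasDerivAt_saddle (A σ s : ℝ) :
    HasDerivAt (saddle A σ)
      (saddle A σ s * (-(A * s * (2 + σ * s * I)) / (1 + σ * s * I) ^ 2)) s := by
  have hne := one_add_mul_I_ne_zero σ s
  have hid : HasDerivAt (fun s : ℝ => (s : ℂ)) 1 s := Complex.ofRealCLM.hasDerivAt
  have h1 : HasDerivAt (fun s : ℝ => -((A : ℂ) * (s : ℂ) ^ 2)) (-(A * (2 * s))) s := by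
    refine ((hid.pow 2).const_mul (A : ℂ)).neg.congr_deriv ?_
    simp
  have h2 : HasDerivAt (fun s : ℝ => (1 + σ * s * I : ℂ)) (σ * I) s := by
    refine (((hid.const_mul (σ : ℂ)).mul_const I).const_add 1).congr_deriv ?_
    ring
  refine (h1.div h2 hne).cexp.congr_deriv ?_
  rw [saddle]
  congr 1
  field_simp
  ring

/-- A primitive, up to a small correction, of `saddle` against the variation of `1 / z`. -/
def saddlePrim (A σ s : ℝ) : ℂ :=
  I / (A * σ) * (saddle A σ s * ((1 + σ * s * I) / (2 + σ * s * I)))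

theorem hasDerivAt_saddlePrim {A σ : ℝ} (hA : A ≠ 0) (hσ : σ ≠ 0) (s : ℝ) :
    HasDerivAt (saddlePrim A σ)
      (-(I * s) / (σ * (1 + σ * s * I)) * saddle A σ s -
        1 / (A * (2 + σ * s * I) ^ 2) * saddle A σ s) s := by
  have hne := one_add_mul_I_ne_zero σ s
  have hne2 := two_add_mul_I_ne_zero σ s
  have hA' : (A : ℂ) ≠ 0 := Complex.ofReal_ne_zero.2 hA
  have hσ' : (σ : ℂ) ≠ 0 := Complex.ofReal_ne_zero.2 hσ
  have hid : HasDerivAt (fun s : ℝ => (s : ℂ)) 1 s := Complex.ofRealCLM.hasDerivAt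
  have h2 : ∀ c : ℂ, HasDerivAt (fun s : ℝ => (c + σ * s * I : ℂ)) (σ * I) s := fun c => by
    refine (((hid.const_mul (σ : ℂ)).mul_const I).const_add c).congr_deriv ?_
    ring
  refine (((hasDerivAt_saddle A σ s).mul ((h2 1).div (h2 2) hne2)).const_mul _).congr_deriv ?_
  simp only [Pi.div_apply]
  have hv : (2 + σ * s * I : ℂ) = (1 + σ * s * I) + 1 := by ring
  rw [hv] at hne2 ⊢
  generalize (1 + σ * s * I : ℂ) = u at hne hne2 ⊢
  field_simp
  linear_combination saddle A σ s * σ * u * I_sq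

theorem integral_variation_mul_saddle {A σ : ℝ} (hA : A ≠ 0) (hσ : σ ≠ 0) (a b : ℝ) :
    ∫ s in a..b, -(I * s) / (σ * (1 + σ * s * I)) * saddle A σ s =
      saddlePrim A σ b - saddlePrim A σ a +
        ∫ s in a..b, 1 / (A * (2 + σ * s * I) ^ 2) * saddle A σ s := by
  have hA' : (A : ℂ) ≠ 0 := Complex.ofReal_ne_zero.2 hA
  have hσ' : (σ : ℂ) ≠ 0 := Complex.ofReal_ne_zero.2 hσ
  have hc1 : Continuous fun s : ℝ => -(I * s) / (σ * (1 + σ * s * I)) * saddle A σ s :=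
    (Continuous.div (by fun_prop) (by fun_prop)
      fun s => mul_ne_zero hσ' (one_add_mul_I_ne_zero σ s)).mul (continuous_saddle A σ)
  have hc2 : Continuous fun s : ℝ => 1 / (A * (2 + σ * s * I) ^ 2) * saddle A σ s :=
    (Continuous.div (by fun_prop) (by fun_prop)
      fun s => mul_ne_zero hA' (pow_ne_zero 2 (two_add_mul_I_ne_zero σ s))).mul
      (continuous_saddle A σ)
  rw [← intervalIntegral.integral_eq_sub_of_hasDerivAt
    (fun s _ => hasDerivAt_saddlePrim hA hσ s) ((hc1.sub hc2).intervalIntegrable _ _),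
    intervalIntegral.integral_sub (hc1.intervalIntegrable _ _) (hc2.intervalIntegrable _ _),
    sub_add_cancel]

theorem tendsto_exp_neg_div_div_pow (c : ℝ) (hc : 0 < c) (k : ℕ) :
    Tendsto (fun σ : ℝ => Real.exp (-(c / σ ^ 2)) / σ ^ k) (nhdsWithin (0 : ℝ) (Set.Ioi 0))
      (nhds 0) := by
  have h1 : Tendsto (fun x : ℝ => x ^ k * Real.exp (-c * x)) atTop (nhds 0) := by
    simpa only [Real.rpow_natCast] using tendsto_rpow_mul_exp_neg_mul_atTop_nhds_zero k c hc
  have h2 : Tendsto (fun σ : ℝ => σ⁻¹) (nhdsWithin (0 : ℝ) (Set.Ioi 0)) atTop :=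
    tendsto_inv_nhdsGT_zero
  refine squeeze_zero' ?_ ?_ (h1.comp h2)
  · filter_upwards [self_mem_nhdsWithin] with σ (hσ : 0 < σ)
    positivity
  · have hlt : ∀ᶠ σ in nhdsWithin (0 : ℝ) (Set.Ioi 0), σ < 1 :=
      nhdsWithin_le_nhds (Iio_mem_nhds one_pos)
    filter_upwards [self_mem_nhdsWithin, hlt] with σ (hσ : 0 < σ) hσ1
    simp only [Function.comp_apply]
    rw [div_eq_inv_mul, inv_pow]
    gcongr
    rw [neg_mul, neg_le_neg_iff, ← div_eq_mul_inv]
    gcongr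
    nlinarith

theorem tendsto_saddlePrim {A : ℝ} (hA : 0 < A) {e : ℝ} (he : |e| = 1) :
    Tendsto (fun σ : ℝ => saddlePrim A σ (e * (1 / σ))) (nhdsWithin (0 : ℝ) (Set.Ioi 0))
      (nhds 0) := by
  have h := (tendsto_exp_neg_div_div_pow (A / 2) (by positivity) 1).const_mul (1 / A)
  rw [mul_zero] at h
  refine squeeze_zero_norm' ?_ h
  filter_upwards [self_mem_nhdsWithin] with σ (hσ : 0 < σ)
  have hs : |e * (1 / σ)| ≤ 1 / σ := by
    rw [abs_mul, he, one_mul, abs_of_pos (by positivity)]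
  have he2 : e ^ 2 = 1 := by rw [← sq_abs, he, one_pow]
  have h1 := norm_saddle_le hA hσ hs
  have h2 : ‖(1 + σ * (e * (1 / σ) : ℝ) * I : ℂ) / (2 + σ * (e * (1 / σ) : ℝ) * I)‖ ≤ 1 := by
    rw [norm_div]
    refine div_le_one_of_le₀ ?_ (norm_nonneg _)
    rw [← sq_le_sq₀ (norm_nonneg _) (norm_nonneg _), ← Complex.normSq_eq_norm_sq,
      ← Complex.normSq_eq_norm_sq, Complex.normSq_apply, Complex.normSq_apply]
    simp
    norm_num
  rw [saddlePrim, norm_mul, norm_mul, norm_div, norm_I, norm_mul, Complex.norm_of_nonneg hA.le,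
    Complex.norm_of_nonneg hσ.le]
  have h3 := mul_le_mul h1 h2 (norm_nonneg _) (Real.exp_nonneg _)
  rw [mul_one] at h3
  refine (mul_le_mul_of_nonneg_left h3 (by positivity)).trans_eq ?_
  have h4 : -(A / 2) * (e * (1 / σ)) ^ 2 = -(A / 2 / σ ^ 2) := by
    rw [mul_pow, he2]
    field_simp
  rw [h4]
  field_simp

/-! ### The hook factor near the dominant singularity -/

theorem tendsto_one_div_exp_sub_one :
    Tendsto (fun y : ℂ => 1 / (exp y - 1) - 1 / y) (nhdsWithin 0 {0}ᶜ) (nhds (-(1 / 2))) := by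
  have hid : Tendsto (fun y : ℂ => y) (nhdsWithin 0 {0}ᶜ) (nhds 0) :=
    tendsto_id.mono_left nhdsWithin_le_nhds
  have hne : ∀ᶠ y : ℂ in nhdsWithin 0 {0}ᶜ, y ≠ 0 := self_mem_nhdsWithin
  have hsmall : ∀ᶠ y : ℂ in nhdsWithin 0 {0}ᶜ, ‖y‖ ≤ 1 := by
    filter_upwards [nhdsWithin_le_nhds (Metric.closedBall_mem_nhds (0 : ℂ) one_pos)] with y hy
    simpa using hy
  have h2 : Tendsto (fun y : ℂ => (exp y - 1 - y) / y ^ 2) (nhdsWithin 0 {0}ᶜ)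
      (nhds (1 / 2)) := by
    rw [tendsto_iff_norm_sub_tendsto_zero]
    refine squeeze_zero' (Eventually.of_forall fun _ => norm_nonneg _) ?_ (by simpa using hid.norm)
    filter_upwards [hne, hsmall] with y hy hy1
    have h := Complex.exp_bound hy1 (n := 3) (by norm_num)
    have heq : (exp y - 1 - y) / y ^ 2 - 1 / 2 =
        (exp y - ∑ m ∈ Finset.range 3, y ^ m / m.factorial) / y ^ 2 := by
      simp [Finset.sum_range_succ]
      field_simp
      ring
    rw [heq, norm_div, norm_pow, div_le_iff₀ (by positivity)]
    refine h.trans ?_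
    rw [← pow_succ']
    refine mul_le_of_le_one_right (by positivity) ?_
    norm_num [Nat.factorial]
  have h1 : Tendsto (fun y : ℂ => 1 + y * ((exp y - 1 - y) / y ^ 2)) (nhdsWithin 0 {0}ᶜ)
      (nhds 1) := by
    simpa using (hid.mul h2).const_add 1
  have h := (h2.div h1 one_ne_zero).neg
  rw [div_one] at h
  refine h.congr' ?_
  filter_upwards [hne, h1.eventually_ne one_ne_zero] with y hy hy1
  have hexp : exp y - 1 ≠ 0 := fun h0 => hy1 (by
    rw [h0]
    field_simp
    ring)
  have h3 : 1 + y * ((exp y - 1 - y) / y ^ 2) = (exp y - 1) / y := by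
    field_simp
    ring
  simp only [Pi.div_apply]
  rw [h3]
  field_simp
  ring

theorem tendsto_hookFactor {t : ℕ} (ht : 1 ≤ t) :
    Tendsto (fun z : ℂ => hookFactor t (exp (-z)) - 1 / (2 * z)) (nhdsWithin 0 {0}ᶜ)
      (nhds ((-(t : ℝ) / 2 + delta t / 4 : ℝ) : ℂ)) := by
  have ht0 : (t : ℂ) ≠ 0 := Nat.cast_ne_zero.2 (by lia)
  have hy : Tendsto (fun z : ℂ => 2 * t * z) (nhdsWithin 0 {0}ᶜ) (nhdsWithin 0 {0}ᶜ) := by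
    refine tendsto_nhdsWithin_iff.2 ⟨?_, ?_⟩
    · refine Tendsto.mono_left ?_ nhdsWithin_le_nhds
      have hc : Continuous fun z : ℂ => 2 * t * z := by fun_prop
      simpa using hc.tendsto 0
    · filter_upwards [self_mem_nhdsWithin] with z hz
      exact mul_ne_zero (mul_ne_zero two_ne_zero ht0) hz
  have h1 := (tendsto_one_div_exp_sub_one.comp hy).const_mul (t : ℂ)
  have h2 : Tendsto (fun z : ℂ => (if Odd t then 1 else 0) *
      (exp (-z) ^ t / (1 + exp (-z) ^ t) ^ 2)) (nhdsWithin 0 {0}ᶜ)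
      (nhds ((if Odd t then 1 else 0) * (1 / 4))) := by
    refine Tendsto.mono_left ?_ nhdsWithin_le_nhds
    have hc : ContinuousAt (fun z : ℂ => (if Odd t then 1 else 0) *
        (exp (-z) ^ t / (1 + exp (-z) ^ t) ^ 2)) 0 := by
      refine ContinuousAt.mul continuousAt_const (ContinuousAt.div (by fun_prop) (by fun_prop) ?_)
      simp
    convert hc.tendsto using 2
    norm_num
  have hlim : ((-(t : ℝ) / 2 + delta t / 4 : ℝ) : ℂ) =
      t * -(1 / 2) + (if Odd t then 1 else 0) * (1 / 4) := by
    rw [delta]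
    split_ifs <;> push_cast <;> ring
  rw [hlim]
  refine (h1.add h2).congr' ?_
  filter_upwards [self_mem_nhdsWithin] with z hz
  have hz0 : z ≠ 0 := hz
  have hq : exp (2 * t * z) * exp (-z) ^ (2 * t) = 1 := by
    rw [← Complex.exp_nat_mul, ← Complex.exp_add]
    push_cast
    rw [show 2 * t * z + 2 * t * -z = 0 by ring, Complex.exp_zero]
  have hq0 : exp (-z) ^ (2 * t) ≠ 0 := pow_ne_zero _ (Complex.exp_ne_zero _)
  have hq1 : exp (2 * t * z) = (exp (-z) ^ (2 * t))⁻¹ := eq_inv_of_mul_eq_one_left hq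
  simp only [Function.comp_apply, hookFactor, hq1]
  generalize exp (-z) ^ (2 * t) = p at hq0
  by_cases hp : 1 - p = 0
  · obtain rfl : p = 1 := (sub_eq_zero.1 hp).symm
    simp
    field_simp
    ring
  · have hp' : p⁻¹ - 1 = (1 - p) / p := by field_simp
    rw [hp']
    field_simp
    ring

theorem norm_hookFactor_sub_le {t : ℕ} (ht : 1 ≤ t) {τ : ℝ} (hτ : 0 < τ) (hτ1 : τ ≤ 1) {q : ℂ}
    (hq : ‖q‖ = Real.exp (-τ)) :
    ‖hookFactor t q - 1 / (2 * τ)‖ ≤ (2 * t + 5) / τ ^ 2 := by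
  have hlt : ‖q‖ < 1 := by
    rw [hq]
    exact Real.exp_lt_one_iff.2 (by linarith)
  have hgap : τ / 2 ≤ 1 - ‖q‖ := by
    have h1 : Real.exp (-τ) ≤ 1 / (1 + τ) := by
      rw [Real.exp_neg, ← one_div]
      exact one_div_le_one_div_of_le (by positivity) (by linarith [Real.add_one_le_exp τ])
    have h2 : 1 / (1 + τ) ≤ 1 - τ / 2 := by
      rw [div_le_iff₀ (by positivity)]
      nlinarith
    rw [hq]
    linarith
  have hpow : ∀ k : ℕ, k ≠ 0 → ‖q ^ k‖ ≤ ‖q‖ := fun k hk => by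
    rw [norm_pow]
    exact pow_le_of_le_one (norm_nonneg _) hlt.le hk
  have hle : ∀ k : ℕ, k ≠ 0 → ‖q ^ k‖ ≤ 1 := fun k hk => (hpow k hk).trans hlt.le
  have hsub : τ / 2 ≤ ‖1 - q ^ (2 * t)‖ := by
    have h := norm_sub_norm_le (1 : ℂ) (q ^ (2 * t))
    rw [norm_one] at h
    linarith [hpow (2 * t) (by lia)]
  have hadd : τ / 2 ≤ ‖1 + q ^ t‖ := by
    have h := norm_sub_norm_le (1 : ℂ) (-q ^ t)
    rw [norm_one, norm_neg, sub_neg_eq_add] at h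
    linarith [hpow t (by lia)]
  have h1 : ‖t * q ^ (2 * t) / (1 - q ^ (2 * t))‖ ≤ t * 1 / (τ / 2) := by
    rw [norm_div, norm_mul, Complex.norm_natCast]
    gcongr
    exact hle _ (by lia)
  have h2 : ‖(if Odd t then 1 else 0) * (q ^ t / (1 + q ^ t) ^ 2)‖ ≤ 1 * (1 / (τ / 2) ^ 2) := by
    rw [norm_mul, norm_div, norm_pow ((1 : ℂ) + _)]
    gcongr
    · split_ifs <;> simp
    · exact hle _ (by lia)
  have h3 : ‖(1 / (2 * τ) : ℂ)‖ = 1 / (2 * τ) := by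
    rw [norm_div, norm_mul, Complex.norm_of_nonneg hτ.le]
    simp
  rw [hookFactor]
  refine (norm_sub_le _ _).trans ?_
  rw [h3]
  refine (add_le_add_left ((norm_add_le _ _).trans (add_le_add h1 h2)) _).trans ?_
  rw [← sub_nonneg]
  have : (2 * t + 5) / τ ^ 2 - (t * 1 / (τ / 2) + 1 * (1 / (τ / 2) ^ 2) + 1 / (2 * τ)) =
      (2 * t * (1 - τ) + (1 - τ / 2)) / τ ^ 2 := by
    field_simp
    ring
  rw [this]
  have h4 : 0 ≤ 1 - τ := by linarith
  have h5 : 0 ≤ 1 - τ / 2 := by linarith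
  positivity

/-! ### Coefficients as integrals over the major arc -/

/-- The growth constant of `genFun` at `1`. -/
def growthConst : ℝ := π ^ 2 / 24

theorem growthConst_pos : 0 < growthConst := by
  unfold growthConst
  positivity

/-- The point of the circle of radius `exp (-σ ^ 2)` at rescaled angle `s`. -/
def arcPoint (σ s : ℝ) : ℂ := (σ ^ 2 : ℝ) + (σ ^ 3 * s : ℝ) * I

/-- The quotient of `genFun` by its exponential singular part, along the arc. -/
def genFunRatio (σ s : ℝ) : ℂ := genFun (exp (-arcPoint σ s)) * exp (-(growthConst / arcPoint σ s))

theorem arcPoint_eq (σ s : ℝ) : arcPoint σ s = σ ^ 2 * (1 + σ * s * I) := by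
  rw [arcPoint]
  push_cast
  ring

theorem arcPoint_re (σ s : ℝ) : (arcPoint σ s).re = σ ^ 2 := by
  simp only [arcPoint, add_re, ofReal_re, re_ofReal_mul, I_re, mul_zero, add_zero]

theorem arcPoint_im (σ s : ℝ) : (arcPoint σ s).im = σ ^ 3 * s := by
  simp only [arcPoint, add_im, ofReal_im, im_ofReal_mul, I_im, mul_one, zero_add]

theorem arcPoint_ne_zero {σ : ℝ} (hσ : 0 < σ) (s : ℝ) : arcPoint σ s ≠ 0 := fun h => by
  have h1 := arcPoint_re σ s
  rw [h, zero_re] at h1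
  exact absurd h1.symm (pow_pos hσ 2).ne'

theorem abs_arcPoint_im_le {σ s : ℝ} (hσ : 0 < σ) (hs : |s| ≤ 1 / σ) :
    |(arcPoint σ s).im| ≤ (arcPoint σ s).re := by
  rw [arcPoint_im, arcPoint_re, show σ ^ 3 * s = σ ^ 2 * (σ * s) by ring, abs_mul,
    abs_of_pos (by positivity)]
  exact mul_le_of_le_one_right (by positivity) (abs_mul_le_one hσ hs)

theorem norm_arcPoint_le {σ s : ℝ} (hσ : 0 < σ) (hs : |s| ≤ 1 / σ) :
    ‖arcPoint σ s‖ ≤ 2 * σ ^ 2 :=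
  (norm_le_two_mul_re (abs_arcPoint_im_le hσ hs)).trans_eq (by rw [arcPoint_re])

theorem continuous_arcPoint (σ : ℝ) : Continuous (arcPoint σ) := by
  unfold arcPoint
  fun_prop

theorem norm_exp_neg_arcPoint (σ s : ℝ) : ‖exp (-arcPoint σ s)‖ = Real.exp (-σ ^ 2) :=
  norm_exp_neg_add_mul_I _ _

theorem norm_exp_neg_arcPoint_lt_one {σ : ℝ} (hσ : 0 < σ) (s : ℝ) : ‖exp (-arcPoint σ s)‖ < 1 := by
  rw [norm_exp_neg_arcPoint]
  exact Real.exp_lt_one_iff.2 (neg_lt_zero.2 (by positivity))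

theorem continuous_genFun_arcPoint {σ : ℝ} (hσ : 0 < σ) :
    Continuous fun s => genFun (exp (-arcPoint σ s)) := by
  have hs : Summable fun k => ((oddSets k).card : ℂ) * exp (-((σ ^ 2 : ℝ) : ℂ)) ^ k :=
    summable_genFun (norm_exp_neg_lt_one (by rw [ofReal_re]; positivity))
  have hc : Continuous fun s : ℝ => σ ^ 3 * s := by fun_prop
  exact (continuous_tsum_mul_exp_pow hs).comp hc

theorem continuous_genFunRatio {σ : ℝ} (hσ : 0 < σ) : Continuous (genFunRatio σ) :=
  (continuous_genFun_arcPoint hσ).mul (Continuous.cexp (Continuous.neg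
    (continuous_const.div (continuous_arcPoint σ) fun s => arcPoint_ne_zero hσ s)))

theorem exists_genFunRatio_eq_exp {σ s : ℝ} (hσ : 0 < σ) (hσ1 : σ ≤ 1) (hs : |s| ≤ 1 / σ) :
    ∃ w, ‖w‖ ≤ 24 * σ ^ 2 ∧ genFunRatio σ s = exp w := by
  obtain ⟨w, hw, h⟩ := exists_genFun_eq_exp (z := arcPoint σ s)
    (by rw [arcPoint_re]; positivity) (abs_arcPoint_im_le hσ hs)
    (by rw [arcPoint_re]; exact pow_le_one₀ hσ.le hσ1)
  refine ⟨w, by linarith [norm_arcPoint_le hσ hs], ?_⟩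
  rw [genFunRatio, h, ← Complex.exp_add, growthConst]
  congr 1
  ring

theorem genFun_mul_exp_arcPoint {σ : ℝ} (hσ : 0 < σ) {n : ℕ} (hn : n * σ ^ 4 = growthConst)
    (s : ℝ) :
    genFun (exp (-arcPoint σ s)) * exp (n * arcPoint σ s) =
      Real.exp (2 * growthConst / σ ^ 2) * (genFunRatio σ s * saddle growthConst σ s) := by
  have hσ' : (σ : ℂ) ≠ 0 := Complex.ofReal_ne_zero.2 hσ.ne'
  have hne := one_add_mul_I_ne_zero σ s
  have hn' : (n : ℂ) * σ ^ 4 = growthConst := by exact_mod_cast hn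
  have hphase : (n : ℂ) * arcPoint σ s = (2 * growthConst / σ ^ 2 : ℝ) +
      -(growthConst / arcPoint σ s) + -(growthConst * s ^ 2) / (1 + σ * s * I) := by
    have hn2 : (n : ℂ) = growthConst / σ ^ 4 := by
      rw [← hn']
      field_simp
    rw [hn2, arcPoint_eq]
    push_cast
    field_simp
    linear_combination (growthConst : ℂ) * (σ : ℂ) ^ 2 * s ^ 2 * I_sq
  rw [genFunRatio, saddle, hphase, Complex.exp_add, Complex.exp_add, Complex.ofReal_exp]
  ring

theorem norm_genFun_exp_neg_le {τ : ℝ} (hτ : 0 < τ) (hτ1 : τ ≤ 1) :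
    ‖genFun (exp (-(τ : ℂ)))‖ ≤ Real.exp (growthConst / τ + 12) := by
  obtain ⟨w, hw, h⟩ := exists_genFun_eq_exp (z := (τ : ℂ)) (by simpa using hτ)
    (by simpa using hτ.le) (by simpa using hτ1)
  rw [Complex.norm_of_nonneg hτ.le] at hw
  rw [h, Complex.norm_exp, add_re, ← Complex.ofReal_div, ofReal_re]
  refine Real.exp_le_exp.2 ?_
  rw [growthConst]
  linarith [Complex.re_le_norm w]

theorem norm_integral_sub_arc_le {Φ : ℝ → ℂ} (hΦ : Continuous Φ) {σ : ℝ} (hσ : 0 < σ)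
    (hσ1 : σ ≤ 1) {M : ℝ} (hM : ∀ θ : ℝ, σ ^ 2 ≤ |θ| → |θ| ≤ π → ‖Φ θ‖ ≤ M) :
    ‖(∫ θ in -π..π, Φ θ) - σ ^ 3 * ∫ s in -(1 / σ)..1 / σ, Φ (σ ^ 3 * s)‖ ≤ 2 * π * M := by
  have hτ : σ ^ 2 ≤ 1 := pow_le_one₀ hσ.le hσ1
  have hpi : σ ^ 2 ≤ π := hτ.trans (by linarith [Real.pi_gt_three])
  have hM0 : 0 ≤ M := (norm_nonneg _).trans
    (hM π (by rwa [abs_of_pos Real.pi_pos]) (abs_of_pos Real.pi_pos).le)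
  have hint : ∀ a b, IntervalIntegrable Φ MeasureTheory.volume a b :=
    fun a b => hΦ.intervalIntegrable a b
  have hscale : (σ ^ 3 : ℂ) * ∫ s in -(1 / σ)..1 / σ, Φ (σ ^ 3 * s) =
      ∫ θ in -σ ^ 2..σ ^ 2, Φ θ := by
    have h := intervalIntegral.smul_integral_comp_mul_left (a := -(1 / σ)) (b := 1 / σ) Φ (σ ^ 3)
    rw [Complex.real_smul] at h
    push_cast at h
    rw [h]
    congr 1 <;> field_simp
  have hsplit : (∫ θ in -π..π, Φ θ) - ∫ θ in -σ ^ 2..σ ^ 2, Φ θ =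
      (∫ θ in -π..-σ ^ 2, Φ θ) + ∫ θ in σ ^ 2..π, Φ θ := by
    rw [← intervalIntegral.integral_add_adjacent_intervals (hint (-π) (-σ ^ 2)) (hint (-σ ^ 2) π),
      ← intervalIntegral.integral_add_adjacent_intervals (hint (-σ ^ 2) (σ ^ 2)) (hint (σ ^ 2) π)]
    ring
  have hσ2 : 0 < σ ^ 2 := by positivity
  have hleft : ‖∫ θ in -π..-σ ^ 2, Φ θ‖ ≤ M * |-σ ^ 2 - -π| := by
    refine intervalIntegral.norm_integral_le_of_norm_le_const fun θ hθ => ?_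
    rw [Set.uIoc_of_le (by linarith)] at hθ
    have habs : |θ| = -θ := abs_of_neg (by linarith [hθ.2])
    exact hM θ (by linarith [hθ.2]) (by linarith [hθ.1])
  have hright : ‖∫ θ in σ ^ 2..π, Φ θ‖ ≤ M * |π - σ ^ 2| := by
    refine intervalIntegral.norm_integral_le_of_norm_le_const fun θ hθ => ?_
    rw [Set.uIoc_of_le hpi] at hθ
    have habs : |θ| = θ := abs_of_pos (by linarith [hθ.1])
    exact hM θ (by linarith [hθ.1]) (by linarith [hθ.2])
  rw [abs_of_nonneg (by linarith)] at hleft hright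
  rw [hscale, hsplit]
  refine (norm_add_le _ _).trans ?_
  nlinarith

theorem norm_coeff_sub_integral_le {R : ℕ → ℂ} {g : ℂ → ℂ} {σ : ℝ} (hσ : 0 < σ) (hσ1 : σ ≤ 1)
    (hR : Summable fun k => R k * exp (-((σ ^ 2 : ℝ) : ℂ)) ^ k)
    (hg : ∀ q : ℂ, ‖q‖ < 1 → ∑' k, R k * q ^ k = genFun q * g q) {M : ℝ}
    (hM : ∀ q : ℂ, ‖q‖ = Real.exp (-σ ^ 2) → ‖g q‖ ≤ M) {n : ℕ}
    (hn : n * σ ^ 4 = growthConst) :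
    ‖2 * π * R n / (Real.exp (2 * growthConst / σ ^ 2) * σ ^ 3) -
        ∫ s in -(1 / σ)..1 / σ,
          g (exp (-arcPoint σ s)) * genFunRatio σ s * saddle growthConst σ s‖ ≤
      2 * π * M * Real.exp 12 * (Real.exp (-(1 / 1000 / σ ^ 2)) / σ ^ 3) := by
  have hτ : 0 < σ ^ 2 := by positivity
  have hτ1 : σ ^ 2 ≤ 1 := pow_le_one₀ hσ.le hσ1
  have hσ' : (σ : ℂ) ≠ 0 := Complex.ofReal_ne_zero.2 hσ.ne'
  have hlt : ∀ θ : ℝ, ‖exp (-((σ ^ 2 : ℝ) + θ * I))‖ < 1 := fun θ => by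
    rw [norm_exp_neg_add_mul_I]
    exact Real.exp_lt_one_iff.2 (by linarith)
  have hnτ : n * σ ^ 2 = growthConst / σ ^ 2 := by
    rw [← hn]
    field_simp
  have hM0 : 0 ≤ M := (norm_nonneg _).trans (hM _ (norm_exp_ofReal_neg _))
  have hΦ : Continuous fun θ : ℝ => (∑' k, R k * exp (-((σ ^ 2 : ℝ) + θ * I)) ^ k) *
      exp (n * ((σ ^ 2 : ℝ) + θ * I)) :=
    (continuous_tsum_mul_exp_pow hR).mul (by fun_prop)
  have harc := norm_integral_sub_arc_le hΦ hσ hσ1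
    (M := Real.exp (2 * growthConst / σ ^ 2) * (M * Real.exp 12 * Real.exp (-(1 / 1000 / σ ^ 2))))
    fun θ h1 h2 => by
      rw [hg _ (hlt θ), norm_mul, norm_mul, Complex.norm_exp]
      have hre : ((n : ℂ) * ((σ ^ 2 : ℝ) + θ * I)).re = growthConst / σ ^ 2 := by
        rw [← hnτ]
        simp [-Complex.ofReal_pow]
      have hmin := (norm_genFun_minor_arc hτ hτ1 h1 h2).trans
        (mul_le_mul_of_nonneg_right (norm_genFun_exp_neg_le hτ hτ1) (Real.exp_nonneg _))
      rw [hre]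
      refine (mul_le_mul_of_nonneg_right (mul_le_mul hmin (hM _ (norm_exp_neg_add_mul_I _ _))
        (norm_nonneg _) (by positivity)) (Real.exp_nonneg _)).trans_eq ?_
      rw [show 2 * growthConst / σ ^ 2 = growthConst / σ ^ 2 + growthConst / σ ^ 2 by ring,
        Real.exp_add, Real.exp_add, show 1 / (1000 * σ ^ 2) = 1 / 1000 / σ ^ 2 by ring]
      ring
  rw [integral_tsum_mul_exp hR n] at harc
  have hint : (∫ s in -(1 / σ)..1 / σ,
      (∑' k, R k * exp (-((σ ^ 2 : ℝ) + (σ ^ 3 * s : ℝ) * I)) ^ k) *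
        exp (n * ((σ ^ 2 : ℝ) + (σ ^ 3 * s : ℝ) * I))) =
      Real.exp (2 * growthConst / σ ^ 2) * ∫ s in -(1 / σ)..1 / σ,
        g (exp (-arcPoint σ s)) * genFunRatio σ s * saddle growthConst σ s := by
    rw [← intervalIntegral.integral_const_mul]
    refine intervalIntegral.integral_congr fun s _ => ?_
    have h1 : ∑' k, R k * exp (-((σ ^ 2 : ℝ) + (σ ^ 3 * s : ℝ) * I)) ^ k =
        genFun (exp (-arcPoint σ s)) * g (exp (-arcPoint σ s)) :=
      hg _ (norm_exp_neg_arcPoint_lt_one hσ s)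
    have h2 : genFun (exp (-arcPoint σ s)) * exp (n * ((σ ^ 2 : ℝ) + (σ ^ 3 * s : ℝ) * I)) =
        Real.exp (2 * growthConst / σ ^ 2) * (genFunRatio σ s * saddle growthConst σ s) :=
      genFun_mul_exp_arcPoint hσ hn s
    simp only [h1]
    linear_combination g (exp (-arcPoint σ s)) * h2
  rw [hint] at harc
  have hE : (Real.exp (2 * growthConst / σ ^ 2) : ℂ) ≠ 0 :=
    Complex.ofReal_ne_zero.2 (Real.exp_ne_zero _)
  generalize (∫ s in -(1 / σ)..1 / σ,
    g (exp (-arcPoint σ s)) * genFunRatio σ s * saddle growthConst σ s) = J at harc ⊢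
  have hfac : 2 * π * R n / (Real.exp (2 * growthConst / σ ^ 2) * σ ^ 3) - J =
      (2 * π * R n - σ ^ 3 * (Real.exp (2 * growthConst / σ ^ 2) * J)) /
        (Real.exp (2 * growthConst / σ ^ 2) * σ ^ 3) := by
    field_simp
  rw [hfac, norm_div, norm_mul, norm_pow, Complex.norm_of_nonneg hσ.le,
    Complex.norm_of_nonneg (Real.exp_nonneg _), div_le_iff₀ (by positivity)]
  refine harc.trans_eq ?_
  field_simp

/-! ### Limits of the arc integrals -/

theorem norm_genFunRatio_sub_one_le {σ s : ℝ} (hσ : 0 < σ) (hσ1 : σ ≤ 1 / 5) (hs : |s| ≤ 1 / σ) :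
    ‖genFunRatio σ s - 1‖ ≤ 48 * σ ^ 2 := by
  obtain ⟨w, hw, h⟩ := exists_genFunRatio_eq_exp hσ (by linarith) hs
  have hw1 : ‖w‖ ≤ 1 := hw.trans (by nlinarith)
  rw [h]
  linarith [Complex.norm_exp_sub_one_le hw1]

theorem norm_genFunRatio_le {σ s : ℝ} (hσ : 0 < σ) (hσ1 : σ ≤ 1 / 5) (hs : |s| ≤ 1 / σ) :
    ‖genFunRatio σ s‖ ≤ 3 := by
  have h1 := norm_genFunRatio_sub_one_le hσ hσ1 hs
  have h2 := norm_add_le (genFunRatio σ s - 1) 1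
  rw [sub_add_cancel, norm_one] at h2
  nlinarith

theorem eventually_pos_le {c : ℝ} (hc : 0 < c) :
    ∀ᶠ σ in nhdsWithin (0 : ℝ) (Set.Ioi 0), 0 < σ ∧ σ ≤ c := by
  filter_upwards [self_mem_nhdsWithin, nhdsWithin_le_nhds (Iic_mem_nhds hc)] with σ h1 h2
  exact ⟨h1, h2⟩

theorem eventually_abs_le_one_div (s : ℝ) :
    ∀ᶠ σ in nhdsWithin (0 : ℝ) (Set.Ioi 0), |s| ≤ 1 / σ := by
  simp only [one_div]
  exact tendsto_inv_nhdsGT_zero.eventually_ge_atTop _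

theorem tendsto_genFunRatio (s : ℝ) :
    Tendsto (fun σ => genFunRatio σ s) (nhdsWithin (0 : ℝ) (Set.Ioi 0)) (nhds 1) := by
  rw [tendsto_iff_norm_sub_tendsto_zero]
  have h : Tendsto (fun σ : ℝ => 48 * σ ^ 2) (nhdsWithin (0 : ℝ) (Set.Ioi 0)) (nhds 0) := by
    refine Tendsto.mono_left ?_ nhdsWithin_le_nhds
    have hc : Continuous fun σ : ℝ => 48 * σ ^ 2 := by fun_prop
    simpa using hc.tendsto 0
  refine squeeze_zero' (Eventually.of_forall fun _ => norm_nonneg _) ?_ h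
  filter_upwards [eventually_pos_le (c := 1 / 5) (by norm_num), eventually_abs_le_one_div s]
    with σ hσ hs
  exact norm_genFunRatio_sub_one_le hσ.1 hσ.2 hs

theorem tendsto_integral_genFunRatio :
    Tendsto (fun σ : ℝ => ∫ s in -(1 / σ)..1 / σ, genFunRatio σ s * saddle growthConst σ s)
      (nhdsWithin (0 : ℝ) (Set.Ioi 0)) (nhds (√(π / growthConst))) := by
  have h := tendsto_integral_mul_saddle growthConst_pos (f := genFunRatio) (f₀ := 1) (C := 3)
    (fun σ hσ => continuous_genFunRatio hσ) ?_ tendsto_genFunRatio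
  · rwa [one_mul] at h
  · filter_upwards [eventually_pos_le (c := 1 / 5) (by norm_num)] with σ hσ s hs
    exact (norm_genFunRatio_le hσ.1 hσ.2 hs).trans (by linarith [abs_nonneg s])

theorem one_div_arcPoint_sub {σ : ℝ} (hσ : 0 < σ) (s : ℝ) :
    1 / arcPoint σ s - 1 / (σ : ℂ) ^ 2 = -(I * s) / (σ * (1 + σ * s * I)) := by
  have hσ' : (σ : ℂ) ≠ 0 := Complex.ofReal_ne_zero.2 hσ.ne'
  have hne := one_add_mul_I_ne_zero σ s
  rw [arcPoint_eq]
  field_simp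
  ring

theorem norm_variation_le {σ : ℝ} (hσ : 0 < σ) (s : ℝ) :
    ‖-(I * s) / (σ * (1 + σ * s * I) : ℂ)‖ ≤ |s| / σ := by
  have h : 1 ≤ ‖(1 + σ * s * I : ℂ)‖ := by
    have h1 := Complex.abs_re_le_norm (1 + σ * s * I : ℂ)
    simpa using h1
  rw [norm_div, norm_neg, norm_mul, norm_mul, norm_I, one_mul, Complex.norm_real,
    Complex.norm_of_nonneg hσ.le, Real.norm_eq_abs]
  gcongr
  exact le_mul_of_one_le_right hσ.le h

theorem norm_correction_le (A σ s : ℝ) (hA : 0 < A) :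
    ‖(1 / (A * (2 + σ * s * I) ^ 2) : ℂ)‖ ≤ 1 / (4 * A) := by
  have h : 2 ≤ ‖(2 + σ * s * I : ℂ)‖ := by
    have h1 := Complex.abs_re_le_norm (2 + σ * s * I : ℂ)
    simpa using h1
  rw [norm_div, norm_one, norm_mul, norm_pow, Complex.norm_of_nonneg hA.le]
  refine one_div_le_one_div_of_le (by positivity) ?_
  rw [mul_comm]
  gcongr
  nlinarith

/-- The regular part of `hookFactor` along the arc. -/
def hookRemainder (t : ℕ) (σ s : ℝ) : ℂ :=
  hookFactor t (exp (-arcPoint σ s)) - 1 / (2 * arcPoint σ s)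

theorem continuous_hookRemainder {t : ℕ} (ht : 1 ≤ t) {σ : ℝ} (hσ : 0 < σ) :
    Continuous (hookRemainder t σ) := by
  have hq : Continuous fun s => exp (-arcPoint σ s) := (continuous_arcPoint σ).neg.cexp
  have hlt := norm_exp_neg_arcPoint_lt_one hσ
  unfold hookRemainder hookFactor
  refine Continuous.sub (Continuous.add ?_ (Continuous.mul continuous_const ?_)) ?_
  · exact (continuous_const.mul (hq.pow _)).div (continuous_const.sub (hq.pow _))
      fun s => one_sub_pow_ne_zero (hlt s) (by lia)
  · exact (hq.pow _).div ((continuous_const.add (hq.pow _)).pow 2)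
      fun s => pow_ne_zero 2 (one_add_pow_ne_zero (hlt s) (by lia))
  · exact continuous_const.div (continuous_const.mul (continuous_arcPoint σ))
      fun s => mul_ne_zero two_ne_zero (arcPoint_ne_zero hσ s)

theorem eventually_norm_hookRemainder_sub_lt {t : ℕ} (ht : 1 ≤ t) {ε : ℝ} (hε : 0 < ε) :
    ∀ᶠ σ in nhdsWithin (0 : ℝ) (Set.Ioi 0), ∀ s, |s| ≤ 1 / σ →
      ‖hookRemainder t σ s - ((-(t : ℝ) / 2 + delta t / 4 : ℝ) : ℂ)‖ < ε := by
  have h := Metric.tendsto_nhds.1 (tendsto_hookFactor ht) ε hε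
  rw [eventually_nhdsWithin_iff, Metric.eventually_nhds_iff] at h
  obtain ⟨η, hη, h⟩ := h
  filter_upwards [eventually_pos_le (c := min 1 (η / 3)) (by positivity)] with σ hσ s hs
  have h1 := norm_arcPoint_le hσ.1 hs
  have h2 : σ ≤ 1 := hσ.2.trans (min_le_left _ _)
  have h3 : σ ≤ η / 3 := hσ.2.trans (min_le_right _ _)
  have h4 := h (y := arcPoint σ s) (by
    rw [dist_zero_right]
    nlinarith [hσ.1]) (arcPoint_ne_zero hσ.1 s)
  rwa [dist_eq_norm] at h4

/-- The integrand governing the second order term, after an integration by parts. -/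
def secondOrder (t : ℕ) (σ s : ℝ) : ℂ :=
  hookRemainder t σ s * genFunRatio σ s +
    (1 / 2 * (-(I * s) / (σ * (1 + σ * s * I)) * (genFunRatio σ s - 1)) +
      1 / 2 * (1 / (growthConst * (2 + σ * s * I) ^ 2)))

theorem continuous_secondOrder {t : ℕ} (ht : 1 ≤ t) {σ : ℝ} (hσ : 0 < σ) :
    Continuous (secondOrder t σ) := by
  have hσ' : (σ : ℂ) ≠ 0 := Complex.ofReal_ne_zero.2 hσ.ne'
  have hA' : (growthConst : ℂ) ≠ 0 := Complex.ofReal_ne_zero.2 growthConst_pos.ne'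
  have hρ := continuous_genFunRatio hσ
  refine ((continuous_hookRemainder ht hσ).mul hρ).add
    ((continuous_const.mul (Continuous.mul ?_ (hρ.sub continuous_const))).add
      (continuous_const.mul ?_))
  · exact Continuous.div (by fun_prop) (by fun_prop)
      fun s => mul_ne_zero hσ' (one_add_mul_I_ne_zero σ s)
  · exact Continuous.div (by fun_prop) (by fun_prop)
      fun s => mul_ne_zero hA' (pow_ne_zero 2 (two_add_mul_I_ne_zero σ s))

theorem norm_variation_mul_sub_one_le {σ s : ℝ} (hσ : 0 < σ) (hσ1 : σ ≤ 1 / 5)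
    (hs : |s| ≤ 1 / σ) :
    ‖-(I * s) / (σ * (1 + σ * s * I)) * (genFunRatio σ s - 1)‖ ≤ 48 * σ * |s| := by
  rw [norm_mul]
  refine (mul_le_mul (norm_variation_le hσ s) (norm_genFunRatio_sub_one_le hσ hσ1 hs)
    (norm_nonneg _) (by positivity)).trans_eq ?_
  field_simp

theorem tendsto_secondOrder {t : ℕ} (ht : 1 ≤ t) (s : ℝ) :
    Tendsto (fun σ => secondOrder t σ s) (nhdsWithin (0 : ℝ) (Set.Ioi 0))
      (nhds ((-(t : ℝ) / 2 + delta t / 4 + 1 / (8 * growthConst) : ℝ) : ℂ)) := by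
  have hA' : (growthConst : ℂ) ≠ 0 := Complex.ofReal_ne_zero.2 growthConst_pos.ne'
  have h1 : Tendsto (fun σ => hookRemainder t σ s) (nhdsWithin (0 : ℝ) (Set.Ioi 0))
      (nhds ((-(t : ℝ) / 2 + delta t / 4 : ℝ) : ℂ)) := by
    refine Metric.tendsto_nhds.2 fun ε hε => ?_
    filter_upwards [eventually_norm_hookRemainder_sub_lt ht hε, eventually_abs_le_one_div s]
      with σ h hs
    rw [dist_eq_norm]
    exact h s hs
  have h2 : Tendsto (fun σ : ℝ => -(I * s) / (σ * (1 + σ * s * I)) * (genFunRatio σ s - 1))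
      (nhdsWithin (0 : ℝ) (Set.Ioi 0)) (nhds 0) := by
    have h : Tendsto (fun σ : ℝ => 48 * σ * |s|) (nhdsWithin (0 : ℝ) (Set.Ioi 0)) (nhds 0) := by
      refine Tendsto.mono_left ?_ nhdsWithin_le_nhds
      have hc : Continuous fun σ : ℝ => 48 * σ * |s| := by fun_prop
      simpa using hc.tendsto 0
    refine squeeze_zero_norm' ?_ h
    filter_upwards [eventually_pos_le (c := 1 / 5) (by norm_num), eventually_abs_le_one_div s]
      with σ hσ hs
    exact norm_variation_mul_sub_one_le hσ.1 hσ.2 hs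
  have h3 : Tendsto (fun σ : ℝ => (1 / (growthConst * (2 + σ * s * I) ^ 2) : ℂ))
      (nhdsWithin (0 : ℝ) (Set.Ioi 0)) (nhds (1 / (growthConst * (2 + (0 : ℝ) * s * I) ^ 2))) := by
    refine Tendsto.mono_left ?_ nhdsWithin_le_nhds
    refine ContinuousAt.tendsto (x := (0 : ℝ))
      (f := fun σ : ℝ => (1 / (growthConst * (2 + σ * s * I) ^ 2) : ℂ)) ?_
    exact ContinuousAt.div (by fun_prop) (by fun_prop)
      (mul_ne_zero hA' (pow_ne_zero 2 (two_add_mul_I_ne_zero 0 s)))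
  have h := (h1.mul (tendsto_genFunRatio s)).add
    ((h2.const_mul (1 / 2)).add (h3.const_mul (1 / 2)))
  have hlim : ((-(t : ℝ) / 2 + delta t / 4 + 1 / (8 * growthConst) : ℝ) : ℂ) =
      ((-(t : ℝ) / 2 + delta t / 4 : ℝ) : ℂ) * 1 +
        (1 / 2 * 0 + 1 / 2 * (1 / (growthConst * (2 + (0 : ℝ) * s * I) ^ 2))) := by
    push_cast
    field_simp
    ring
  rw [hlim]
  exact h

theorem eventually_norm_secondOrder_le {t : ℕ} (ht : 1 ≤ t) :
    ∃ C, ∀ᶠ σ in nhdsWithin (0 : ℝ) (Set.Ioi 0), ∀ s, |s| ≤ 1 / σ →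
      ‖secondOrder t σ s‖ ≤ C * (1 + |s|) := by
  set r₀ : ℂ := ((-(t : ℝ) / 2 + delta t / 4 : ℝ) : ℂ) with hr₀
  refine ⟨(‖r₀‖ + 1) * 3 + 24 + 1 / (8 * growthConst), ?_⟩
  filter_upwards [eventually_norm_hookRemainder_sub_lt ht one_pos,
    eventually_pos_le (c := 1 / 5) (by norm_num)] with σ hr hσ s hs
  have hA := growthConst_pos
  have h1 : ‖hookRemainder t σ s‖ ≤ ‖r₀‖ + 1 := by
    have h := norm_add_le (hookRemainder t σ s - r₀) r₀
    rw [sub_add_cancel] at h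
    linarith [hr s hs]
  have h2 : ‖hookRemainder t σ s * genFunRatio σ s‖ ≤ (‖r₀‖ + 1) * 3 := by
    rw [norm_mul]
    exact mul_le_mul h1 (norm_genFunRatio_le hσ.1 hσ.2 hs) (norm_nonneg _) (by positivity)
  have h3 : ‖(1 / 2 : ℂ) * (-(I * s) / (σ * (1 + σ * s * I)) * (genFunRatio σ s - 1))‖ ≤
      24 * |s| := by
    rw [norm_mul]
    have h := norm_variation_mul_sub_one_le hσ.1 hσ.2 hs
    have hhalf : ‖(1 / 2 : ℂ)‖ = 1 / 2 := by norm_num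
    rw [hhalf]
    nlinarith [abs_nonneg s, hσ.2]
  have h4 : ‖(1 / 2 : ℂ) * (1 / (growthConst * (2 + σ * s * I) ^ 2))‖ ≤
      1 / (8 * growthConst) := by
    rw [norm_mul]
    have h := norm_correction_le growthConst σ s hA
    have hhalf : ‖(1 / 2 : ℂ)‖ = 1 / 2 := by norm_num
    rw [hhalf]
    calc _ ≤ 1 / 2 * (1 / (4 * growthConst)) := by gcongr
      _ = _ := by field_simp; norm_num
  refine (norm_add_le _ _).trans ((add_le_add h2 ((norm_add_le _ _).trans
    (add_le_add h3 h4))).trans ?_)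
  have h5 : 0 ≤ ((‖r₀‖ + 1) * 3 + 1 / (8 * growthConst)) * |s| := by positivity
  nlinarith

theorem tendsto_integral_hookFactor {t : ℕ} (ht : 1 ≤ t) :
    Tendsto (fun σ : ℝ => ∫ s in -(1 / σ)..1 / σ,
        (hookFactor t (exp (-arcPoint σ s)) - 1 / (2 * (σ ^ 2 : ℝ))) * genFunRatio σ s *
          saddle growthConst σ s)
      (nhdsWithin (0 : ℝ) (Set.Ioi 0))
      (nhds (((-(t : ℝ) / 2 + delta t / 4 + 1 / (8 * growthConst) : ℝ) : ℂ) *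
        √(π / growthConst))) := by
  obtain ⟨C, hC⟩ := eventually_norm_secondOrder_le ht
  have hmain := tendsto_integral_mul_saddle growthConst_pos (f := secondOrder t)
    (fun σ hσ => continuous_secondOrder ht hσ) hC (tendsto_secondOrder ht)
  have hplus := tendsto_saddlePrim growthConst_pos (e := 1) (by norm_num)
  have hminus := tendsto_saddlePrim growthConst_pos (e := -1) (by norm_num)
  have h := hmain.add ((hplus.sub hminus).const_mul (1 / 2))
  rw [sub_zero, mul_zero, add_zero] at h
  refine h.congr' ?_
  filter_upwards [self_mem_nhdsWithin] with σ (hσ : 0 < σ)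
  have hσ' : (σ : ℂ) ≠ 0 := Complex.ofReal_ne_zero.2 hσ.ne'
  have hA' : (growthConst : ℂ) ≠ 0 := Complex.ofReal_ne_zero.2 growthConst_pos.ne'
  have hs := continuous_saddle growthConst σ
  have hvar := integral_variation_mul_saddle growthConst_pos.ne' hσ.ne' (-(1 / σ)) (1 / σ)
  have hc1 : Continuous fun s : ℝ =>
      -(I * s) / (σ * (1 + σ * s * I)) * saddle growthConst σ s :=
    (Continuous.div (by fun_prop) (by fun_prop)
      fun s => mul_ne_zero hσ' (one_add_mul_I_ne_zero σ s)).mul hs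
  have hc2 : Continuous fun s : ℝ =>
      1 / (growthConst * (2 + σ * s * I) ^ 2) * saddle growthConst σ s :=
    (Continuous.div (by fun_prop) (by fun_prop)
      fun s => mul_ne_zero hA' (pow_ne_zero 2 (two_add_mul_I_ne_zero σ s))).mul hs
  have hc3 : Continuous fun s => secondOrder t σ s * saddle growthConst σ s :=
    (continuous_secondOrder ht hσ).mul hs
  have hc4 : Continuous fun s : ℝ =>
      1 / 2 * (-(I * s) / (σ * (1 + σ * s * I)) * saddle growthConst σ s -
        1 / (growthConst * (2 + σ * s * I) ^ 2) * saddle growthConst σ s) :=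
    continuous_const.mul (hc1.sub hc2)
  have hint : ∀ s : ℝ, (hookFactor t (exp (-arcPoint σ s)) - 1 / (2 * (σ ^ 2 : ℝ))) *
      genFunRatio σ s * saddle growthConst σ s =
      secondOrder t σ s * saddle growthConst σ s +
        1 / 2 * (-(I * s) / (σ * (1 + σ * s * I)) * saddle growthConst σ s -
          1 / (growthConst * (2 + σ * s * I) ^ 2) * saddle growthConst σ s) := by
    intro s
    have hz := one_div_arcPoint_sub hσ s
    rw [secondOrder, hookRemainder, ← hz]
    have h1 : 1 / (2 * arcPoint σ s) = 1 / 2 * (1 / arcPoint σ s) := by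
      rw [one_div_mul_one_div]
    have h2 : (1 / (2 * (σ ^ 2 : ℝ)) : ℂ) = 1 / 2 * (1 / (σ : ℂ) ^ 2) := by
      rw [one_div_mul_one_div, Complex.ofReal_pow]
    rw [h1, h2]
    ring
  simp only [hint]
  rw [intervalIntegral.integral_add (hc3.intervalIntegrable _ _)
    (hc4.intervalIntegrable _ _), intervalIntegral.integral_const_mul,
    intervalIntegral.integral_sub (hc1.intervalIntegrable _ _) (hc2.intervalIntegrable _ _),
    hvar, one_mul, neg_one_mul]
  ring

/-! ### Asymptotics of the coefficients -/

/-- The scale `σ` for which `σ ^ 2` is the saddle point of the `n`-th coefficient. -/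
def saddleScale (n : ℕ) : ℝ := √√(growthConst / n)

theorem mul_saddleScale_pow_four {n : ℕ} (hn : 1 ≤ n) : n * saddleScale n ^ 4 = growthConst := by
  have hn' : (n : ℝ) ≠ 0 := Nat.cast_ne_zero.2 (by lia)
  have hA := growthConst_pos
  rw [saddleScale, show ∀ x : ℝ, x ^ 4 = (x ^ 2) ^ 2 by intro x; ring,
    Real.sq_sqrt (Real.sqrt_nonneg _), Real.sq_sqrt (by positivity)]
  field_simp

theorem saddleScale_pos {n : ℕ} (hn : 1 ≤ n) : 0 < saddleScale n := by
  have hn' : (0 : ℝ) < n := Nat.cast_pos.2 (by lia)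
  exact Real.sqrt_pos.2 (Real.sqrt_pos.2 (div_pos growthConst_pos hn'))

theorem one_div_two_mul_saddleScale_sq {n : ℕ} (hn : 1 ≤ n) :
    1 / (2 * saddleScale n ^ 2) = √(6 * n) / π := by
  have hn' : (0 : ℝ) < n := Nat.cast_pos.2 (by lia)
  have hσ := saddleScale_pos hn
  have h4 := mul_saddleScale_pow_four hn
  have hpi := Real.pi_pos
  rw [← sq_eq_sq₀ (by positivity) (by positivity), div_pow, div_pow,
    Real.sq_sqrt (by positivity), one_pow, div_eq_div_iff (by positivity) (by positivity)]
  rw [growthConst] at h4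
  linear_combination -24 * h4

theorem tendsto_saddleScale :
    Tendsto saddleScale atTop (nhdsWithin (0 : ℝ) (Set.Ioi 0)) := by
  refine tendsto_nhdsWithin_iff.2 ⟨?_, ?_⟩
  · have h := (tendsto_const_div_atTop_nhds_zero_nat growthConst).sqrt.sqrt
    rwa [Real.sqrt_zero, Real.sqrt_zero] at h
  · filter_upwards [eventually_ge_atTop 1] with n hn
    exact saddleScale_pos hn

theorem tendsto_coeff {R : ℝ → ℕ → ℂ} {g : ℝ → ℂ → ℂ} {K : ℝ} {L : ℂ}
    (hR : ∀ σ : ℝ, ∀ q : ℂ, ‖q‖ < 1 → Summable fun k => R σ k * q ^ k)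
    (hg : ∀ σ : ℝ, ∀ q : ℂ, ‖q‖ < 1 → ∑' k, R σ k * q ^ k = genFun q * g σ q)
    (hK : ∀ σ : ℝ, 0 < σ → σ ≤ 1 → ∀ q : ℂ, ‖q‖ = Real.exp (-σ ^ 2) → ‖g σ q‖ ≤ K / σ ^ 4)
    (hL : Tendsto (fun σ : ℝ => ∫ s in -(1 / σ)..1 / σ,
        g σ (exp (-arcPoint σ s)) * genFunRatio σ s * saddle growthConst σ s)
      (nhdsWithin (0 : ℝ) (Set.Ioi 0)) (nhds L)) :
    Tendsto (fun n => 2 * π * R (saddleScale n) n /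
        (Real.exp (2 * growthConst / saddleScale n ^ 2) * saddleScale n ^ 3 : ℂ))
      atTop (nhds L) := by
  have herr : Tendsto (fun σ : ℝ => 2 * π * K * Real.exp 12 *
      (Real.exp (-(1 / 1000 / σ ^ 2)) / σ ^ 7)) (nhdsWithin (0 : ℝ) (Set.Ioi 0)) (nhds 0) := by
    have h := (tendsto_exp_neg_div_div_pow (1 / 1000) (by norm_num) 7).const_mul
      (2 * π * K * Real.exp 12)
    rwa [mul_zero] at h
  refine tendsto_of_tendsto_of_dist (hL.comp tendsto_saddleScale) ?_
  refine squeeze_zero' (Eventually.of_forall fun _ => dist_nonneg) ?_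
    (herr.comp tendsto_saddleScale)
  filter_upwards [eventually_ge_atTop 1,
    tendsto_saddleScale.eventually (eventually_pos_le one_pos)] with n hn hσ
  obtain ⟨hσ0, hσ1⟩ := hσ
  have hq : ‖exp (-((saddleScale n ^ 2 : ℝ) : ℂ))‖ < 1 :=
    norm_exp_neg_lt_one (by rw [ofReal_re]; positivity)
  have h := norm_coeff_sub_integral_le hσ0 hσ1 (hR _ _ hq) (hg _) (hK _ hσ0 hσ1)
    (mul_saddleScale_pow_four hn)
  rw [dist_comm, dist_eq_norm]
  refine h.trans_eq ?_
  simp only [Function.comp_apply]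
  field_simp

theorem tendsto_card_oddSets :
    Tendsto (fun n => 2 * π * ((oddSets n).card : ℂ) /
        (Real.exp (2 * growthConst / saddleScale n ^ 2) * saddleScale n ^ 3 : ℂ))
      atTop (nhds (√(π / growthConst))) := by
  refine tendsto_coeff (R := fun _ n => ((oddSets n).card : ℂ)) (g := fun _ _ => 1) (K := 1)
    (fun _ _ hq => summable_genFun hq) (fun _ q _ => ?_) (fun σ hσ hσ1 _ _ => ?_) ?_
  · rw [mul_one, genFun]
  · rw [norm_one, le_div_iff₀ (by positivity), one_mul]
    exact pow_le_one₀ hσ.le hσ1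
  · simpa only [one_mul] using tendsto_integral_genFunRatio

theorem tendsto_hookTotal_sub {t : ℕ} (ht : 1 ≤ t) :
    Tendsto (fun n => 2 * π * ((hookTotal t n : ℂ) -
          1 / (2 * (saddleScale n ^ 2 : ℝ)) * ((oddSets n).card : ℂ)) /
        (Real.exp (2 * growthConst / saddleScale n ^ 2) * saddleScale n ^ 3 : ℂ))
      atTop (nhds (((-(t : ℝ) / 2 + delta t / 4 + 1 / (8 * growthConst) : ℝ) : ℂ) *
        √(π / growthConst))) := by
  have hterm : ∀ (σ : ℝ) (q : ℂ) (n : ℕ), ((hookTotal t n : ℂ) -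
      1 / (2 * (σ ^ 2 : ℝ)) * ((oddSets n).card : ℂ)) * q ^ n =
      (hookTotal t n : ℂ) * q ^ n -
        1 / (2 * (σ ^ 2 : ℝ)) * (((oddSets n).card : ℂ) * q ^ n) := fun σ q n => by ring
  refine tendsto_coeff (R := fun σ n => (hookTotal t n : ℂ) -
      1 / (2 * (σ ^ 2 : ℝ)) * ((oddSets n).card : ℂ))
    (g := fun σ q => hookFactor t q - 1 / (2 * (σ ^ 2 : ℝ))) (K := 2 * t + 5)
    (fun σ q hq => ?_) (fun σ q hq => ?_) (fun σ hσ hσ1 q hq => ?_)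
    (tendsto_integral_hookFactor ht)
  · simp only [hterm]
    exact (summable_hookTotal t hq).sub ((summable_genFun hq).mul_left _)
  · simp only [hterm]
    rw [(summable_hookTotal t hq).tsum_sub ((summable_genFun hq).mul_left _), tsum_mul_left,
      tsum_hookTotal ht hq, ← genFun]
    ring
  · have h := norm_hookFactor_sub_le ht (pow_pos hσ 2) (pow_le_one₀ hσ.le hσ1) hq
    rwa [← pow_mul] at h

theorem tendsto_hookTotal_div {t : ℕ} (ht : 1 ≤ t) :
    Tendsto (fun n : ℕ => (hookTotal t n : ℝ) / ((oddSets n).card : ℝ) - √(6 * n) / π)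
      atTop (nhds (-(t : ℝ) / 2 + 3 / π ^ 2 + delta t / 4)) := by
  have hgauss : ((√(π / growthConst) : ℝ) : ℂ) ≠ 0 :=
    Complex.ofReal_ne_zero.2 (Real.sqrt_pos.2 (div_pos Real.pi_pos growthConst_pos)).ne'
  have h := (tendsto_hookTotal_sub ht).div tendsto_card_oddSets hgauss
  rw [mul_div_cancel_right₀ _ hgauss] at h
  have hconst : -(t : ℝ) / 2 + delta t / 4 + 1 / (8 * growthConst) =
      -(t : ℝ) / 2 + 3 / π ^ 2 + delta t / 4 := by
    rw [growthConst]
    field_simp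
    ring
  rw [hconst] at h
  have hre := (Complex.continuous_re.tendsto _).comp h
  rw [Complex.ofReal_re] at hre
  refine hre.congr' ?_
  filter_upwards [eventually_ge_atTop 1, tendsto_card_oddSets.eventually_ne hgauss] with n hn hne
  have hσ : (saddleScale n : ℂ) ≠ 0 := Complex.ofReal_ne_zero.2 (saddleScale_pos hn).ne'
  have hE : (Real.exp (2 * growthConst / saddleScale n ^ 2) : ℂ) ≠ 0 :=
    Complex.ofReal_ne_zero.2 (Real.exp_ne_zero _)
  have hpi : (π : ℂ) ≠ 0 := Complex.ofReal_ne_zero.2 Real.pi_ne_zero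
  have hcard : ((oddSets n).card : ℂ) ≠ 0 := fun h0 => hne (by rw [h0, mul_zero, zero_div])
  simp only [Function.comp_apply, Pi.div_apply]
  rw [← one_div_two_mul_saddleScale_sq hn,
    div_div_div_cancel_right₀ (mul_ne_zero hE (pow_ne_zero 3 hσ)),
    mul_div_mul_left _ _ (mul_ne_zero two_ne_zero hpi), sub_div, mul_div_cancel_right₀ _ hcard]
  rw [← Complex.ofReal_re ((hookTotal t n : ℝ) / ((oddSets n).card : ℝ) -
    1 / (2 * saddleScale n ^ 2))]
  push_cast
  rfl

end

/-- The mean of `N_t` over `SC(n)` satisfies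
`lim_{n→∞} ( (1/sc(n)) Σ_{λ ∈ SC(n)} N_t(λ) - √(6n)/π ) = -t/2 + 3/π² + δ_t/4`. -/
theorem stmt15 (t : ℕ) (ht : 1 ≤ t) :
    Filter.Tendsto (fun n : ℕ =>
        (∑ P ∈ SC n, (Nhook t P : ℝ)) / ((SC n).card : ℝ) - Real.sqrt (6*n)/π)
      Filter.atTop (nhds (-(t:ℝ)/2 + 3/π^2 + delta t/4)) := by
  refine (tendsto_hookTotal_div ht).congr fun n => ?_
  rw [← card_SC, ← sum_Nhook_SC ht, Nat.cast_sum]
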